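/- For every ε > 0 there exists a constant C_ε > 0 such that for every integer M ≥ 2 and all complex numbers a_1, …, a_M, one has (∫_{[0,1]²} |∑_{n=1}^{M} a_n e(n x₁ + n² x₂)|⁶ dx₁ dx₂)^{1/6} ≤ C_ε (log M)^{2+ε} (∑_{n=1}^{M} |a_n|²)^{1/2}, where e(z) := e^{2πiz} and log denotes the natural logarithm. -/

import Mathlib

open MeasureTheory

namespace DRP

open Finset ComplexConjugate

/-- The finite ring of residues mod `3^(2N)`. -/
abbrev Rg (N : ℕ) : Type := ZMod (3 ^ (2 * N))

/-- The finite physical space. -/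
abbrev Xs (N : ℕ) : Type := Rg N × Rg N

/-- The additive character at an integer. -/
noncomputable def ec (N : ℕ) (m : ℤ) : ℂ := ZMod.stdAddChar ((m : ℤ) : Rg N)

lemma ec_add (N : ℕ) (m n : ℤ) : ec N (m + n) = ec N m * ec N n := by
  simp [ec, AddChar.map_add_eq_mul]

lemma ec_zero (N : ℕ) : ec N 0 = 1 := by simp [ec]

lemma ec_eq_one_iff (N : ℕ) (m : ℤ) : ec N m = 1 ↔ (3 : ℤ) ^ (2 * N) ∣ m := by
  have h0 : ec N m = 1 ↔ ((m : ℤ) : Rg N) = 0 := by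
    unfold ec
    constructor
    · intro h
      apply ZMod.injective_stdAddChar
      rw [h]; simp
    · intro h; rw [h]; simp
  rw [h0, ZMod.intCast_zmod_eq_zero_iff_dvd]
  push_cast
  rfl

lemma ec_norm (N : ℕ) (m : ℤ) : ‖ec N m‖ = 1 := by
  rw [ec, ZMod.stdAddChar_apply, Circle.norm_coe]

lemma ec_conj (N : ℕ) (m : ℤ) : conj (ec N m) = ec N (-m) := by
  have h : ec N m * ec N (-m) = 1 := by rw [← ec_add]; simp [ec_zero]
  have h2 : ec N m * conj (ec N m) = 1 := by
    rw [Complex.mul_conj, Complex.normSq_eq_norm_sq, ec_norm]; simp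
  have h3 : ec N m ≠ 0 := by
    intro h0; rw [h0] at h; simp at h
  exact mul_left_cancel₀ h3 (h2.trans h.symm)

lemma ec_congr (N : ℕ) (m n : ℤ) (h : (3 : ℤ) ^ (2 * N) ∣ m - n) : ec N m = ec N n := by
  have : m = (m - n) + n := by ring
  rw [this, ec_add, (ec_eq_one_iff N _).2 h, one_mul]

/-- translation vector -/
def tv (N : ℕ) (h1 h2 : ℤ) : Xs N := ((h1 : Rg N), (h2 : Rg N))

lemma sum_translate {N : ℕ} {β : Type*} [AddCommMonoid β] (Φ : Xs N → β) (h : Xs N) :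
    ∑ x, Φ (x + h) = ∑ x, Φ x := Equiv.sum_comp (Equiv.addRight h) Φ

lemma sum_eq_zero_of_translate {N : ℕ} (Φ : Xs N → ℂ) (h : Xs N) (z : ℂ) (hz : z ≠ 1)
    (hΦ : ∀ x, Φ (x + h) = z * Φ x) : ∑ x, Φ x = 0 := by
  have h1 := sum_translate Φ h
  simp_rw [hΦ, ← Finset.mul_sum] at h1
  have h2 : (z - 1) * ∑ x, Φ x = 0 := by rw [sub_mul, h1]; ring
  rcases mul_eq_zero.1 h2 with h3 | h3
  · exact absurd (sub_eq_zero.1 h3) hz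
  · exact h3

/-- single frequency piece -/
noncomputable def pf (N : ℕ) (b : ℕ → ℂ) (c : ℕ) (x : Xs N) : ℂ :=
  b c * ZMod.stdAddChar ((c : Rg N) * x.1 + (c : Rg N) ^ 2 * x.2)

lemma pf_norm (N : ℕ) (b : ℕ → ℂ) (c : ℕ) (x : Xs N) : ‖pf N b c x‖ = ‖b c‖ := by
  rw [pf, norm_mul, ZMod.stdAddChar_apply, Circle.norm_coe, mul_one]

lemma pf_translate (N : ℕ) (b : ℕ → ℂ) (c : ℕ) (x : Xs N) (h1 h2 : ℤ) :
    pf N b c (x + tv N h1 h2) = ec N (c * h1 + c ^ 2 * h2) * pf N b c x := by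
  unfold pf ec tv
  have : (c : Rg N) * (x + ((h1 : Rg N), (h2 : Rg N))).1
      + (c : Rg N) ^ 2 * (x + ((h1 : Rg N), (h2 : Rg N))).2 =
      (((c * h1 + c ^ 2 * h2 : ℤ)) : Rg N) + ((c : Rg N) * x.1 + (c : Rg N) ^ 2 * x.2) := by
    push_cast
    simp only [Prod.fst_add, Prod.snd_add]
    ring
  rw [this, AddChar.map_add_eq_mul]
  ring

/-- pruning -/
noncomputable def cut (lam : ℝ) (z : ℂ) : ℂ := if ‖z‖ ≤ lam then z else 0

lemma cut_norm_le (lam : ℝ) (z : ℂ) : ‖cut lam z‖ ≤ ‖z‖ := by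
  unfold cut; split_ifs <;> simp

lemma cut_norm_le_lam (lam : ℝ) (hl : 0 ≤ lam) (z : ℂ) : ‖cut lam z‖ ≤ lam := by
  unfold cut; split_ifs with h
  · exact h
  · simpa using hl

lemma cut_mul (lam : ℝ) (z w : ℂ) (hw : ‖w‖ = 1) : cut lam (w * z) = w * cut lam z := by
  unfold cut; rw [norm_mul, hw, one_mul]; split_ifs <;> simp

lemma cut_zero (lam : ℝ) : cut lam 0 = 0 := by
  unfold cut; split_ifs <;> rfl

lemma sub_cut_norm_le (lam : ℝ) (hl : 0 < lam) (z : ℂ) : ‖z - cut lam z‖ ≤ ‖z‖ ^ 2 / lam := by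
  unfold cut; split_ifs with h
  · simp; positivity
  · rw [le_div_iff₀ hl]
    push Not at h
    simp only [sub_zero]
    nlinarith [norm_nonneg z]

/-- pruned pieces, `d` is the depth (level is `N - d`) -/
noncomputable def G (N : ℕ) (b : ℕ → ℂ) (lam : ℝ) : ℕ → ℕ → Xs N → ℂ
  | 0, c, x => pf N b c x
  | d + 1, c, x => ∑ i ∈ range 3, cut lam (G N b lam d (c + 3 ^ (N - d - 1) * i) x)

/-- covariance condition -/
def Cov (N k : ℕ) (c h1 h2 : ℤ) : Prop :=
  (3 : ℤ) ^ (2 * N) ∣ 3 ^ k * (h1 + 2 * c * h2) ∧ (3 : ℤ) ^ (2 * N) ∣ 3 ^ (2 * k) * h2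

lemma G_cov (N : ℕ) (b : ℕ → ℂ) (lam : ℝ) (d : ℕ) : d ≤ N → ∀ (c : ℕ) (h1 h2 : ℤ),
    Cov N (N - d) c h1 h2 → ∀ x, G N b lam d c (x + tv N h1 h2) =
      ec N (c * h1 + c ^ 2 * h2) * G N b lam d c x := by
  induction d with
  | zero => intro _ c h1 h2 _ x; exact pf_translate N b c x h1 h2
  | succ d ih =>
    intro hd c h1 h2 hc x
    obtain ⟨k, hk⟩ : ∃ k, N - (d + 1) = k := ⟨_, rfl⟩
    have hk1 : N - d = k + 1 := by omega
    have hk2 : N - d - 1 = k := by omega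
    rw [hk] at hc
    simp only [G]
    rw [Finset.mul_sum]
    refine Finset.sum_congr rfl fun i _ => ?_
    rw [hk2]
    obtain ⟨⟨u, hu⟩, ⟨v, hv⟩⟩ := hc
    have hcov : Cov N (N - d) ((c + 3 ^ k * i : ℕ) : ℤ) h1 h2 := by
      rw [hk1]
      refine ⟨⟨3 * u + 6 * i * v, ?_⟩, ⟨9 * v, ?_⟩⟩
      · push_cast
        linear_combination 3 * hu + 6 * i * hv
      · linear_combination 9 * hv
    rw [ih (by omega) _ h1 h2 hcov x, cut_mul _ _ _ (ec_norm _ _)]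
    congr 1
    apply ec_congr
    refine ⟨i * u + i ^ 2 * v, ?_⟩
    push_cast
    linear_combination (i : ℤ) * hu + (i : ℤ) ^ 2 * hv

/-- pruned -/
noncomputable def F (N : ℕ) (b : ℕ → ℂ) (lam : ℝ) (d c : ℕ) (x : Xs N) : ℂ :=
  cut lam (G N b lam d c x)

lemma F_cov (N : ℕ) (b : ℕ → ℂ) (lam : ℝ) (d : ℕ) (hd : d ≤ N) (c : ℕ) (h1 h2 : ℤ)
    (hc : Cov N (N - d) c h1 h2) (x : Xs N) : F N b lam d c (x + tv N h1 h2) =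
      ec N (c * h1 + c ^ 2 * h2) * F N b lam d c x := by
  unfold F
  rw [G_cov N b lam d hd c h1 h2 hc x, cut_mul _ _ _ (ec_norm _ _)]

lemma G_supp (N : ℕ) (b : ℕ → ℂ) (lam : ℝ) (j i0 : ℕ) (hb : ∀ n, n % 3 ^ j ≠ i0 → b n = 0)
    (d : ℕ) : d + j ≤ N → ∀ (c : ℕ), c % 3 ^ j ≠ i0 → ∀ x, G N b lam d c x = 0 := by
  induction d with
  | zero => intro _ c hc x; simp [G, pf, hb c hc]
  | succ d ih =>
    intro hd c hc x
    simp only [G]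
    refine Finset.sum_eq_zero fun i _ => ?_
    rw [ih (by omega) _ _ x, cut_zero]
    obtain ⟨m, hm⟩ : ∃ m, N - d - 1 = j + m := ⟨N - d - 1 - j, by omega⟩
    rw [hm, pow_add, mul_assoc, Nat.add_mul_mod_self_left]
    exact hc

lemma sum_range_three (k : ℕ) {β : Type*} [AddCommMonoid β] (φ : ℕ → β) :
    ∑ c ∈ range (3 ^ (k + 1)), φ c = ∑ c ∈ range (3 ^ k), ∑ i ∈ range 3, φ (c + 3 ^ k * i) := by
  have : 3 ^ (k + 1) = 3 ^ k + 3 ^ k + 3 ^ k := by ring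
  rw [this, Finset.sum_range_add, Finset.sum_range_add]
  simp only [Finset.sum_range_succ, Finset.sum_range_zero, zero_add, Finset.sum_add_distrib]
  simp only [mul_zero, add_zero, mul_one]
  congr 1
  · congr 1
    exact Finset.sum_congr rfl fun i _ => by rw [add_comm]
  · exact Finset.sum_congr rfl fun i _ => by congr 1; ring

/-- square functions -/
noncomputable def g (N : ℕ) (b : ℕ → ℂ) (lam : ℝ) (d : ℕ) (x : Xs N) : ℝ :=
  ∑ c ∈ range (3 ^ (N - d)), ‖G N b lam d c x‖ ^ 2

noncomputable def gt (N : ℕ) (b : ℕ → ℂ) (lam : ℝ) (d : ℕ) (x : Xs N) : ℝ :=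
  ∑ c ∈ range (3 ^ (N - d)), ‖F N b lam d c x‖ ^ 2

lemma gt_le (N : ℕ) (b : ℕ → ℂ) (lam : ℝ) (d : ℕ) (x : Xs N) :
    gt N b lam d x ≤ g N b lam d x := by
  unfold gt g
  refine Finset.sum_le_sum fun c _ => ?_
  exact pow_le_pow_left₀ (norm_nonneg _) (cut_norm_le _ _) 2

lemma g_nonneg (N : ℕ) (b : ℕ → ℂ) (lam : ℝ) (d : ℕ) (x : Xs N) :
    0 ≤ g N b lam d x := by
  unfold g; positivity

/-- mass -/
noncomputable def rr (N : ℕ) (b : ℕ → ℂ) : ℝ := ∑ n ∈ range (3 ^ N), ‖b n‖ ^ 2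

lemma g_zero (N : ℕ) (b : ℕ → ℂ) (lam : ℝ) (x : Xs N) : g N b lam 0 x = rr N b := by
  simp [g, rr, G, pf_norm]

/-- off-diagonal part of a node at depth `d+1` -/
noncomputable def hc (N : ℕ) (b : ℕ → ℂ) (lam : ℝ) (d c : ℕ) (x : Xs N) : ℝ :=
  ‖∑ i ∈ range 3, F N b lam d (c + 3 ^ (N - d - 1) * i) x‖ ^ 2
    - ∑ i ∈ range 3, ‖F N b lam d (c + 3 ^ (N - d - 1) * i) x‖ ^ 2

lemma g_succ (N : ℕ) (b : ℕ → ℂ) (lam : ℝ) (d : ℕ) (hd : d + 1 ≤ N) (x : Xs N) :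
    g N b lam (d + 1) x = gt N b lam d x +
      ∑ c ∈ range (3 ^ (N - d - 1)), hc N b lam d c x := by
  unfold g gt hc
  obtain ⟨k, hk⟩ : ∃ k, N - d - 1 = k := ⟨_, rfl⟩
  have hk1 : N - d = k + 1 := by omega
  have hk2 : N - (d + 1) = k := by omega
  rw [hk, hk1, hk2, sum_range_three, ← Finset.sum_add_distrib]
  refine Finset.sum_congr rfl fun c _ => ?_
  simp only [G, F, hk]
  ring

lemma hc_eq (N : ℕ) (b : ℕ → ℂ) (lam : ℝ) (d c : ℕ) (x : Xs N) :
    ((hc N b lam d c x : ℝ) : ℂ) = ∑ i ∈ range 3, ∑ i' ∈ range 3, if i = i' then 0 else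
      F N b lam d (c + 3 ^ (N - d - 1) * i) x * conj (F N b lam d (c + 3 ^ (N - d - 1) * i') x) := by
  unfold hc
  push_cast
  simp only [← Complex.mul_conj', map_sum]
  simp [Finset.sum_range_succ]
  ring

lemma hc_abs (N : ℕ) (b : ℕ → ℂ) (lam : ℝ) (hl : 0 ≤ lam) (d c : ℕ) (x : Xs N) :
    (hc N b lam d c x) ^ 2 ≤
      12 * lam ^ 2 * ∑ i ∈ range 3, ‖F N b lam d (c + 3 ^ (N - d - 1) * i) x‖ ^ 2 := by
  have hF : ∀ a, ‖F N b lam d a x‖ ≤ lam := fun a => cut_norm_le_lam lam hl _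
  unfold hc
  simp only [Finset.sum_range_succ, Finset.sum_range_zero, zero_add]
  set A := F N b lam d (c + 3 ^ (N - d - 1) * 0) x
  set B := F N b lam d (c + 3 ^ (N - d - 1) * 1) x
  set C := F N b lam d (c + 3 ^ (N - d - 1) * 2) x
  have hA : ‖A‖ ≤ lam := hF _
  have hB : ‖B‖ ≤ lam := hF _
  have hC : ‖C‖ ≤ lam := hF _
  have h3 : ‖A + B + C‖ ≤ ‖A‖ + ‖B‖ + ‖C‖ := norm_add₃_le
  set S := ‖A‖ ^ 2 + ‖B‖ ^ 2 + ‖C‖ ^ 2 with hS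
  have hT : ‖A + B + C‖ ^ 2 ≤ 3 * S := by
    have : ‖A + B + C‖ ^ 2 ≤ (‖A‖ + ‖B‖ + ‖C‖) ^ 2 := pow_le_pow_left₀ (norm_nonneg _) h3 2
    nlinarith [sq_nonneg (‖A‖ - ‖B‖), sq_nonneg (‖A‖ - ‖C‖), sq_nonneg (‖C‖ - ‖B‖)]
  have hT0 : 0 ≤ ‖A + B + C‖ ^ 2 := by positivity
  have hS0 : 0 ≤ S := by positivity
  have hS3 : S ≤ 3 * lam ^ 2 := by
    have := pow_le_pow_left₀ (norm_nonneg _) hA 2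
    have := pow_le_pow_left₀ (norm_nonneg _) hB 2
    have := pow_le_pow_left₀ (norm_nonneg _) hC 2
    linarith
  have : (‖A + B + C‖ ^ 2 - S) ^ 2 ≤ (2 * S) ^ 2 := by
    apply sq_le_sq'
    · linarith
    · linarith
  nlinarith

/-- arithmetic: nonvanishing eigenvalue -/
lemma ec_ne_one (N : ℕ) (hN : 1 ≤ N) (m t : ℤ) (ht : m = 3 ^ (2 * N - 1) * t) (h3 : ¬ (3 : ℤ) ∣ t) :
    ec N m ≠ 1 := by
  rw [Ne, ec_eq_one_iff, ht]
  have : 2 * N = (2 * N - 1) + 1 := by omega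
  intro h
  apply h3
  rw [this, pow_succ, Nat.add_sub_cancel] at h
  exact (mul_dvd_mul_iff_left (by positivity)).1 h

lemma not_dvd_sub_of_lt_three (i i' : ℕ) (hi : i < 3) (hi' : i' < 3) (h : i ≠ i') :
    ¬ (3 : ℤ) ∣ (i : ℤ) - i' := by
  omega

lemma G_energy (N : ℕ) (b : ℕ → ℂ) (lam : ℝ) (d : ℕ) (hd : d + 1 ≤ N) (c : ℕ) :
    ∑ x, hc N b lam d c x = 0 := by
  have : ((∑ x, hc N b lam d c x : ℝ) : ℂ) = 0 := by
    push_cast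
    simp_rw [hc_eq]
    rw [Finset.sum_comm]
    refine Finset.sum_eq_zero fun i hi => ?_
    rw [Finset.sum_comm]
    refine Finset.sum_eq_zero fun i' hi' => ?_
    split_ifs with hii
    · simp
    obtain ⟨k, hk⟩ : ∃ k, N - d - 1 = k := ⟨_, rfl⟩
    have hk1 : N - d = k + 1 := by omega
    rw [hk]
    obtain ⟨m, hm⟩ : ∃ m, 2 * N = k + 1 + m := ⟨2 * N - (k + 1), by omega⟩
    have hcov : ∀ a : ℕ, Cov N (N - d) a (3 ^ m) 0 := by
      intro a
      refine ⟨⟨1, ?_⟩, ⟨0, ?_⟩⟩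
      · rw [hk1, hm]; ring
      · ring
    refine sum_eq_zero_of_translate _ (tv N (3 ^ m) 0)
      (ec N ((3 ^ k * ((i : ℤ) - i')) * 3 ^ m)) ?_ ?_
    · apply ec_ne_one N (by omega) _ ((i : ℤ) - i')
      · have : 2 * N - 1 = k + m := by omega
        rw [this]; ring
      · exact not_dvd_sub_of_lt_three i i' (by simpa using hi) (by simpa using hi') hii
    · intro x
      rw [F_cov N b lam d (by omega) _ _ _ (hcov _), F_cov N b lam d (by omega) _ _ _ (hcov _),
        map_mul, ec_conj]
      rw [mul_mul_mul_comm, ← ec_add]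
      congr 2
      push_cast; ring
  exact_mod_cast this

/-- total energies -/
lemma energy_le (N : ℕ) (b : ℕ → ℂ) (lam : ℝ) (d : ℕ) : d ≤ N →
    ∑ x, g N b lam d x ≤ (Fintype.card (Xs N)) * rr N b := by
  induction d with
  | zero => intro _; simp [g_zero]
  | succ d ih =>
    intro hd
    simp_rw [g_succ N b lam d hd]
    rw [Finset.sum_add_distrib, Finset.sum_comm (s := univ) (t := range _)]
    simp_rw [G_energy N b lam d hd]
    simp only [Finset.sum_const_zero, add_zero]
    exact (Finset.sum_le_sum fun x _ => gt_le N b lam d x).trans (ih (by omega))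

end DRP

namespace DRP
open Finset ComplexConjugate

lemma exists_three_decomp (k c c' : ℕ) (hc : c < 3 ^ k) (hc' : c' < 3 ^ k) (hne : c ≠ c') :
    ∃ (i : ℕ) (t : ℤ), i < k ∧ ¬ (3 : ℤ) ∣ t ∧ (c : ℤ) - c' = 3 ^ i * t := by
  have h0 : (c : ℤ) - c' ≠ 0 := by
    intro h; apply hne; omega
  obtain ⟨i, t, ht, hit⟩ := (Int.finiteMultiplicity_iff.2 ⟨(by decide : (3 : ℤ).natAbs ≠ 1), h0⟩).exists_eq_pow_mul_and_not_dvd |> fun h => (⟨_, h.choose, h.choose_spec.2, h.choose_spec.1⟩ : ∃ (i : ℕ) (t : ℤ), ¬ (3 : ℤ) ∣ t ∧ (c : ℤ) - c' = 3 ^ i * t)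
  refine ⟨i, t, ?_, ht, hit⟩
  by_contra hik
  push Not at hik
  have hd : (3 : ℤ) ^ k ∣ (c : ℤ) - c' := by
    rw [hit]; exact (pow_dvd_pow 3 hik).mul_right t
  have := Int.eq_zero_of_abs_lt_dvd hd (by
    have h1 : (c : ℤ) < 3 ^ k := by exact_mod_cast hc
    have h2 : (c' : ℤ) < 3 ^ k := by exact_mod_cast hc'
    rw [abs_lt]; constructor <;> omega)
  exact h0 this

lemma hc_ortho (N : ℕ) (b : ℕ → ℂ) (lam : ℝ) (d : ℕ) (hd : d + 1 ≤ N) (c c' : ℕ)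
    (hcl : c < 3 ^ (N - d - 1)) (hcl' : c' < 3 ^ (N - d - 1)) (hne : c ≠ c') :
    ∑ x, hc N b lam d c x * hc N b lam d c' x = 0 := by
  obtain ⟨k, hk⟩ : ∃ k, N - d - 1 = k := ⟨_, rfl⟩
  have hk1 : N - d = k + 1 := by omega
  rw [hk] at hcl hcl'
  obtain ⟨e, t, hek, ht3, het⟩ := exists_three_decomp k c c' hcl hcl' hne
  obtain ⟨n, hn⟩ : ∃ n, k = e + 1 + n := ⟨k - (e + 1), by omega⟩
  obtain ⟨m, hm⟩ : ∃ m, 2 * N = k + 1 + e + m := ⟨2 * N - (k + 1 + e), by omega⟩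
  set h2 : ℤ := 3 ^ m with hh2
  set h1 : ℤ := -2 * c' * 3 ^ m with hh1
  have hcov : ∀ u : ℕ, Cov N (N - d) ((c + 3 ^ k * u : ℕ) : ℤ) h1 h2 := by
    intro u
    have hcc : (c : ℤ) = c' + 3 ^ e * t := by linarith
    refine ⟨⟨2 * (t + 3 ^ (n + 1) * u), ?_⟩, ⟨3 ^ (n + 2), ?_⟩⟩
    · rw [hk1, hm, hh1, hh2]; push_cast; rw [hcc, hn]; ring
    · rw [hk1, hm, hh2, hn]; ring
  have hcov' : ∀ u : ℕ, Cov N (N - d) ((c' + 3 ^ k * u : ℕ) : ℤ) h1 h2 := by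
    intro u
    refine ⟨⟨2 * (3 ^ (n + 1) * u), ?_⟩, ⟨3 ^ (n + 2), ?_⟩⟩
    · rw [hk1, hm, hh1, hh2, hn]; push_cast; ring
    · rw [hk1, hm, hh2, hn]; ring
  have : ((∑ x, hc N b lam d c x * hc N b lam d c' x : ℝ) : ℂ) = 0 := by
    push_cast
    simp_rw [hc_eq, hk, Finset.sum_mul]
    rw [Finset.sum_comm]
    refine Finset.sum_eq_zero fun i hi => ?_
    rw [Finset.sum_comm]
    refine Finset.sum_eq_zero fun i' hi' => ?_
    split_ifs with hii
    · simp
    simp_rw [Finset.mul_sum]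
    rw [Finset.sum_comm]
    refine Finset.sum_eq_zero fun l hl => ?_
    rw [Finset.sum_comm]
    refine Finset.sum_eq_zero fun l' hl' => ?_
    split_ifs with hll
    · simp
    refine sum_eq_zero_of_translate _ (tv N h1 h2)
      (ec N (3 ^ (2 * N - 1) * (((i : ℤ) - i') * (2 * t + 3 ^ (n + 1) * (i + i'))))) ?_ ?_
    · apply ec_ne_one N (by omega) _ _ rfl
      intro hdvd
      have h3 : Prime (3 : ℤ) := Int.prime_three
      rcases h3.dvd_or_dvd hdvd with h | h
      · exact not_dvd_sub_of_lt_three i i' (by simpa using hi) (by simpa using hi') hii h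
      · have : (3 : ℤ) ∣ 3 ^ (n + 1) * (i + i') := by
          rw [pow_succ]; exact ⟨3 ^ n * (i + i'), by ring⟩
        have h4 : (3 : ℤ) ∣ 2 * t := (dvd_add_left this).1 h
        omega
    · intro x
      rw [F_cov N b lam d (by omega) _ _ _ (hcov _), F_cov N b lam d (by omega) _ _ _ (hcov _),
        F_cov N b lam d (by omega) _ _ _ (hcov' _), F_cov N b lam d (by omega) _ _ _ (hcov' _),
        map_mul, map_mul, ec_conj, ec_conj]
      have key : ∀ (p q r s A B C D : ℂ), p * A * (q * B) * (r * C * (s * D)) =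
        p * q * r * s * (A * B * (C * D)) := by intros; ring
      rw [key, ← ec_add, ← ec_add, ← ec_add]
      congr 1
      apply ec_congr
      have hcc : (c : ℤ) = c' + 3 ^ e * t := by linarith
      have hm1 : 2 * N - 1 = k + e + m := by omega
      refine ⟨((l : ℤ) - l') * 3 ^ n * (l + l'), ?_⟩
      rw [hm1, hm, hh1, hh2]; push_cast; rw [hcc, hn]; ring
  exact_mod_cast this

/-- the high part -/
noncomputable def hh (N : ℕ) (b : ℕ → ℂ) (lam : ℝ) (d : ℕ) (x : Xs N) : ℝ :=
  ∑ c ∈ range (3 ^ (N - d - 1)), hc N b lam d c x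

lemma high_lemma (N : ℕ) (b : ℕ → ℂ) (lam : ℝ) (hl : 0 ≤ lam) (d : ℕ) (hd : d + 1 ≤ N) :
    ∑ x, (hh N b lam d x) ^ 2 ≤ 12 * lam ^ 2 * (Fintype.card (Xs N) * rr N b) := by
  have h1 : ∑ x, (hh N b lam d x) ^ 2 =
      ∑ c ∈ range (3 ^ (N - d - 1)), ∑ x, (hc N b lam d c x) ^ 2 := by
    simp_rw [hh, sq, Finset.sum_mul_sum]
    rw [Finset.sum_comm]
    refine Finset.sum_congr rfl fun c hcm => ?_
    rw [Finset.sum_comm]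
    rw [Finset.sum_eq_single_of_mem c hcm]
    intro c' hcm' hne
    exact hc_ortho N b lam d hd c c' (by simpa using hcm) (by simpa using hcm') hne.symm
  rw [h1]
  calc ∑ c ∈ range (3 ^ (N - d - 1)), ∑ x, (hc N b lam d c x) ^ 2
      ≤ ∑ c ∈ range (3 ^ (N - d - 1)), ∑ x, 12 * lam ^ 2 *
        ∑ i ∈ range 3, ‖F N b lam d (c + 3 ^ (N - d - 1) * i) x‖ ^ 2 :=
        Finset.sum_le_sum fun c _ => Finset.sum_le_sum fun x _ => hc_abs N b lam hl d c x
    _ = 12 * lam ^ 2 * ∑ x, gt N b lam d x := by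
        rw [Finset.sum_comm, Finset.mul_sum]
        refine Finset.sum_congr rfl fun x _ => ?_
        rw [← Finset.mul_sum, gt]
        obtain ⟨k, hk⟩ : ∃ k, N - d - 1 = k := ⟨_, rfl⟩
        have hk1 : N - d = k + 1 := by omega
        rw [hk, hk1, sum_range_three]
    _ ≤ 12 * lam ^ 2 * ∑ x, g N b lam d x := by
        gcongr with x; exact gt_le N b lam d x
    _ ≤ _ := by
        gcongr; exact energy_le N b lam d (by omega)

lemma g_le_sum (N : ℕ) (b : ℕ → ℂ) (lam : ℝ) (x : Xs N) (d : ℕ) : d ≤ N →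
    g N b lam d x ≤ rr N b + ∑ d' ∈ range d, hh N b lam d' x := by
  induction d with
  | zero => intro _; simp [g_zero]
  | succ d ih =>
    intro hd
    rw [g_succ N b lam d hd, Finset.sum_range_succ]
    have := ih (by omega)
    have := gt_le N b lam d x
    unfold hh at *
    linarith

/-- sum of the pruned pieces inside a class mod `3^(j+1)` -/
noncomputable def W (N : ℕ) (b : ℕ → ℂ) (lam : ℝ) (j cls d : ℕ) (x : Xs N) : ℂ :=
  ∑ c ∈ range (3 ^ (N - d)), if c % 3 ^ (j + 1) = cls then G N b lam d c x else 0

lemma W_succ (N : ℕ) (b : ℕ → ℂ) (lam : ℝ) (j cls d : ℕ) (hd : d + 1 + (j + 1) ≤ N) (x : Xs N) :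
    W N b lam j cls (d + 1) x =
      ∑ c ∈ range (3 ^ (N - d)), if c % 3 ^ (j + 1) = cls then F N b lam d c x else 0 := by
  unfold W
  obtain ⟨k, hk⟩ : ∃ k, N - d - 1 = k := ⟨_, rfl⟩
  have hk1 : N - d = k + 1 := by omega
  have hk2 : N - (d + 1) = k := by omega
  rw [hk1, hk2, sum_range_three]
  refine Finset.sum_congr rfl fun c _ => ?_
  obtain ⟨m, hm⟩ : ∃ m, k = (j + 1) + m := ⟨k - (j + 1), by omega⟩
  have : ∀ i, (c + 3 ^ k * i) % 3 ^ (j + 1) = c % 3 ^ (j + 1) := by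
    intro i; rw [hm, pow_add, mul_assoc, Nat.add_mul_mod_self_left]
  simp_rw [this]
  split_ifs
  · simp only [G, F, hk]
  · simp

lemma W_diff (N : ℕ) (b : ℕ → ℂ) (lam : ℝ) (hl : 0 < lam) (j cls d : ℕ)
    (hd : d + 1 + (j + 1) ≤ N) (x : Xs N) :
    ‖W N b lam j cls d x - W N b lam j cls (d + 1) x‖ ≤ g N b lam d x / lam := by
  rw [W_succ N b lam j cls d hd, W, ← Finset.sum_sub_distrib]
  refine (norm_sum_le _ _).trans ?_
  rw [g, Finset.sum_div]
  refine Finset.sum_le_sum fun c _ => ?_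
  split_ifs
  · exact sub_cut_norm_le lam hl _
  · simp; positivity

lemma W_far (N : ℕ) (b : ℕ → ℂ) (lam : ℝ) (hl : 0 < lam) (j cls : ℕ) (x : Xs N) (A : ℝ) (d : ℕ) :
    d + (j + 1) ≤ N → (∀ d' < d, g N b lam d' x ≤ A) →
    ‖W N b lam j cls 0 x - W N b lam j cls d x‖ ≤ d * (A / lam) := by
  induction d with
  | zero => intro _ _; simp
  | succ d ih =>
    intro hd hA
    have h1 := ih (by omega) (fun d' hd' => hA d' (by omega))
    have h2 := W_diff N b lam hl j cls d hd x
    have h3 : g N b lam d x / lam ≤ A / lam := by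
      gcongr; exact hA d (by omega)
    have h4 := norm_sub_le_norm_sub_add_norm_sub (W N b lam j cls 0 x) (W N b lam j cls d x)
      (W N b lam j cls (d + 1) x)
    push_cast
    linarith
end DRP

namespace DRP
open Finset ComplexConjugate

lemma arith_bil (κ : ℕ) (u v α α' β β' : ℤ) (huv : ¬ (3 : ℤ) ∣ u - v)
    (h1 : (3 : ℤ) ^ κ ∣ (u + 3 * α) + (v + 3 * β) - (u + 3 * α') - (v + 3 * β'))
    (h2 : (3 : ℤ) ^ κ ∣ (u + 3 * α) ^ 2 + (v + 3 * β) ^ 2 - (u + 3 * α') ^ 2 - (v + 3 * β') ^ 2) :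
    (3 : ℤ) ^ κ ∣ (u + 3 * α) - (u + 3 * α') := by
  have h3 : (3 : ℤ) ^ κ ∣ ((u + 3 * α) - (u + 3 * α')) *
      (2 * (u - v) + 3 * (α + α' - β - β')) := by
    have := dvd_sub h2 (h1.mul_right ((v + 3 * β) + (v + 3 * β')))
    refine (this).trans (dvd_of_eq ?_)
    ring
  refine IsCoprime.dvd_of_dvd_mul_right ?_ h3
  apply IsCoprime.pow_left
  rw [Prime.coprime_iff_not_dvd Int.prime_three]
  omega

lemma eq_of_pow_dvd (k a a' : ℕ) (ha : a < 3 ^ k) (ha' : a' < 3 ^ k)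
    (h : (3 : ℤ) ^ k ∣ (a : ℤ) - a') : a = a' := by
  have := Int.eq_zero_of_abs_lt_dvd h (by
    have h1 : (a : ℤ) < 3 ^ k := by exact_mod_cast ha
    have h2 : (a' : ℤ) < 3 ^ k := by exact_mod_cast ha'
    rw [abs_lt]; constructor <;> omega)
  omega

/-- admissible translations -/
def Adm (N j i0 k : ℕ) (h1 h2 : ℤ) : Prop :=
  ∀ c : ℕ, c % 3 ^ j = i0 → ∀ l, k ≤ l → Cov N l c h1 h2

lemma class_decomp (j i0 u a : ℕ) (ha : a % 3 ^ (j + 1) = i0 + 3 ^ j * u) :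
    ∃ α : ℤ, (a : ℤ) = i0 + 3 ^ j * (u + 3 * α) := by
  refine ⟨((a / 3 ^ (j + 1) : ℕ) : ℤ), ?_⟩
  have := Nat.mod_add_div a (3 ^ (j + 1))
  rw [ha] at this
  have h2 : ((i0 + 3 ^ j * u + 3 ^ (j + 1) * (a / 3 ^ (j + 1)) : ℕ) : ℤ) = a := by rw [this]
  rw [← h2]; push_cast; ring

lemma class_mod (j i0 u a : ℕ) (hi : i0 < 3 ^ j) (ha : a % 3 ^ (j + 1) = i0 + 3 ^ j * u) :
    a % 3 ^ j = i0 := by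
  have : a % 3 ^ (j + 1) % 3 ^ j = a % 3 ^ j := Nat.mod_mod_of_dvd _ (pow_dvd_pow 3 (by omega))
  rw [← this, ha, Nat.add_mul_mod_self_left, Nat.mod_eq_of_lt hi]

lemma quad_zero (N : ℕ) (b : ℕ → ℂ) (lam : ℝ) (j i0 : ℕ) (hi0 : i0 < 3 ^ j) (u v : ℕ)
    (hu : u < 3) (hv : v < 3) (huv : u ≠ v) (d : ℕ) (hd : d + (j + 1) ≤ N)
    (w : Xs N → ℝ) (hw : ∀ h1 h2, Adm N j i0 (N - d) h1 h2 → ∀ x, w (x + tv N h1 h2) = w x)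
    (a a' c c' : ℕ) (hal : a < 3 ^ (N - d)) (hal' : a' < 3 ^ (N - d)) (hcl : c < 3 ^ (N - d))
    (hcl' : c' < 3 ^ (N - d))
    (ha : a % 3 ^ (j + 1) = i0 + 3 ^ j * u) (ha' : a' % 3 ^ (j + 1) = i0 + 3 ^ j * u)
    (hc : c % 3 ^ (j + 1) = i0 + 3 ^ j * v) (hc' : c' % 3 ^ (j + 1) = i0 + 3 ^ j * v)
    (hne : ¬ (a = a' ∧ c = c')) :
    ∑ x, (w x : ℂ) * (G N b lam d a x * G N b lam d c x *
      (conj (G N b lam d a' x) * conj (G N b lam d c' x))) = 0 := by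
  obtain ⟨k, hk⟩ : ∃ k, N - d = k := ⟨_, rfl⟩
  rw [hk] at hal hal' hcl hcl' hw
  have hjk : j + 1 ≤ k := by omega
  have main : ∀ h1 h2 : ℤ, Adm N j i0 k h1 h2 →
      ¬ (3 : ℤ) ^ (2 * N) ∣ ((a : ℤ) + c - a' - c') * h1 + ((a : ℤ) ^ 2 + c ^ 2 - a' ^ 2 - c' ^ 2) * h2 →
      ∑ x, (w x : ℂ) * (G N b lam d a x * G N b lam d c x *
      (conj (G N b lam d a' x) * conj (G N b lam d c' x))) = 0 := by
    intro h1 h2 hA hnd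
    refine sum_eq_zero_of_translate _ (tv N h1 h2) (ec N (((a : ℤ) + c - a' - c') * h1 +
      ((a : ℤ) ^ 2 + c ^ 2 - a' ^ 2 - c' ^ 2) * h2)) ?_ ?_
    · rw [Ne, ec_eq_one_iff]; exact hnd
    · intro x
      have hcov : ∀ n u, n % 3 ^ (j + 1) = i0 + 3 ^ j * u → Cov N (N - d) n h1 h2 := by
        intro n u hn
        rw [hk]
        exact hA n (class_mod j i0 u n hi0 hn) k le_rfl
      rw [hw h1 h2 hA, G_cov N b lam d (by omega) _ _ _ (hcov _ _ ha),
        G_cov N b lam d (by omega) _ _ _ (hcov _ _ ha'),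
        G_cov N b lam d (by omega) _ _ _ (hcov _ _ hc),
        G_cov N b lam d (by omega) _ _ _ (hcov _ _ hc'), map_mul, map_mul, ec_conj, ec_conj]
      have key : ∀ (w p q r s A B C D : ℂ), w * (p * A * (q * B) * (r * C * (s * D))) =
        p * q * r * s * (w * (A * B * (C * D))) := by intros; ring
      rw [key, ← ec_add, ← ec_add, ← ec_add]
      congr 2
      ring
  by_cases hs : (3 : ℤ) ^ k ∣ (a : ℤ) + c - a' - c'
  · obtain ⟨m, hm⟩ : ∃ m, 2 * N = k + j + m := ⟨2 * N - (k + j), by omega⟩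
    apply main (-2 * i0 * 3 ^ m) (3 ^ m)
    · intro n hn l hl
      obtain ⟨l', rfl⟩ := Nat.exists_eq_add_of_le hl
      obtain ⟨γ, hγ⟩ : ∃ γ : ℤ, (n : ℤ) = i0 + 3 ^ j * γ := by
        refine ⟨((n / 3 ^ j : ℕ) : ℤ), ?_⟩
        have := Nat.mod_add_div n (3 ^ j)
        rw [hn] at this
        exact_mod_cast this.symm
      obtain ⟨κ, hκ⟩ : ∃ κ, k = j + κ := ⟨k - j, by omega⟩
      refine ⟨⟨2 * γ * 3 ^ l', ?_⟩, ⟨3 ^ (κ + 2 * l'), ?_⟩⟩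
      · rw [hm, hγ]; ring
      · rw [hm, hκ]; ring
    · intro hdvd
      apply hne
      obtain ⟨κ, hκ⟩ : ∃ κ, k = j + κ := ⟨k - j, by omega⟩
      obtain ⟨α, hα⟩ := class_decomp j i0 u a ha
      obtain ⟨α', hα'⟩ := class_decomp j i0 u a' ha'
      obtain ⟨β, hβ⟩ := class_decomp j i0 v c hc
      obtain ⟨β', hβ'⟩ := class_decomp j i0 v c' hc'
      have e1 : (3 : ℤ) ^ κ ∣ (u + 3 * α) + (v + 3 * β) - (u + 3 * α') - (v + 3 * β') := by
        rw [hκ, hα, hα', hβ, hβ', pow_add] at hs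
        have : ((i0 : ℤ) + 3 ^ j * (u + 3 * α)) + (i0 + 3 ^ j * (v + 3 * β)) -
          (i0 + 3 ^ j * (u + 3 * α')) - (i0 + 3 ^ j * (v + 3 * β')) =
          3 ^ j * ((u + 3 * α) + (v + 3 * β) - (u + 3 * α') - (v + 3 * β')) := by ring
        rw [this] at hs
        exact (mul_dvd_mul_iff_left (by positivity)).1 hs
      have e2 : (3 : ℤ) ^ κ ∣ (u + 3 * α) ^ 2 + (v + 3 * β) ^ 2 - (u + 3 * α') ^ 2
          - (v + 3 * β') ^ 2 := by
        have h5 : ((a : ℤ) + c - a' - c') * (-2 * i0 * 3 ^ m) +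
          ((a : ℤ) ^ 2 + c ^ 2 - a' ^ 2 - c' ^ 2) * 3 ^ m = 3 ^ (j + j + m) *
          ((u + 3 * α) ^ 2 + (v + 3 * β) ^ 2 - (u + 3 * α') ^ 2 - (v + 3 * β') ^ 2) := by
          rw [hα, hα', hβ, hβ']; ring
        have h6 : (3 : ℤ) ^ (2 * N) = 3 ^ (j + j + m) * 3 ^ κ := by
          rw [hm, hκ]; ring
        rw [h5, h6] at hdvd
        exact (mul_dvd_mul_iff_left (by positivity)).1 hdvd
      have e3 := arith_bil κ u v α α' β β' (not_dvd_sub_of_lt_three u v hu hv huv) e1 e2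
      have haa : a = a' := by
        apply eq_of_pow_dvd k a a' hal hal'
        rw [hκ, pow_add]
        have : (a : ℤ) - a' = 3 ^ j * ((u + 3 * α) - (u + 3 * α')) := by rw [hα, hα']; ring
        rw [this]
        exact mul_dvd_mul_left _ e3
      refine ⟨haa, ?_⟩
      apply eq_of_pow_dvd k c c' hcl hcl'
      rw [haa] at hs
      convert hs using 1
      ring
  · obtain ⟨m, hm⟩ : ∃ m, 2 * N = k + m := ⟨2 * N - k, by omega⟩
    apply main (3 ^ m) 0
    · intro n hn l hl
      obtain ⟨l', rfl⟩ := Nat.exists_eq_add_of_le hl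
      refine ⟨⟨3 ^ l', ?_⟩, ⟨0, by ring⟩⟩
      rw [hm]; ring
    · rw [hm]
      intro h
      apply hs
      rw [pow_add, mul_zero, add_zero] at h
      exact (mul_dvd_mul_iff_right (by positivity)).1 h

lemma bil (N : ℕ) (b : ℕ → ℂ) (lam : ℝ) (j i0 : ℕ) (hi0 : i0 < 3 ^ j) (u v : ℕ)
    (hu : u < 3) (hv : v < 3) (huv : u ≠ v) (d : ℕ) (hd : d + (j + 1) ≤ N)
    (w : Xs N → ℝ) (hw0 : ∀ x, 0 ≤ w x)
    (hw : ∀ h1 h2, Adm N j i0 (N - d) h1 h2 → ∀ x, w (x + tv N h1 h2) = w x) :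
    ∑ x, w x * (‖W N b lam j (i0 + 3 ^ j * u) d x‖ ^ 2 * ‖W N b lam j (i0 + 3 ^ j * v) d x‖ ^ 2) ≤
      ∑ x, w x * (g N b lam d x) ^ 2 := by
  set A : ℕ → Xs N → ℂ := fun a x => if a % 3 ^ (j + 1) = i0 + 3 ^ j * u then G N b lam d a x else 0
    with hA
  set B : ℕ → Xs N → ℂ := fun a x => if a % 3 ^ (j + 1) = i0 + 3 ^ j * v then G N b lam d a x else 0
    with hB
  have key : ∑ x, w x * (‖W N b lam j (i0 + 3 ^ j * u) d x‖ ^ 2 *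
      ‖W N b lam j (i0 + 3 ^ j * v) d x‖ ^ 2) =
      ∑ a ∈ range (3 ^ (N - d)), ∑ c ∈ range (3 ^ (N - d)),
        ∑ x, w x * (‖A a x‖ ^ 2 * ‖B c x‖ ^ 2) := by
    have : ((∑ x, w x * (‖W N b lam j (i0 + 3 ^ j * u) d x‖ ^ 2 *
      ‖W N b lam j (i0 + 3 ^ j * v) d x‖ ^ 2) : ℝ) : ℂ) =
      ((∑ a ∈ range (3 ^ (N - d)), ∑ c ∈ range (3 ^ (N - d)),
        ∑ x, w x * (‖A a x‖ ^ 2 * ‖B c x‖ ^ 2) : ℝ) : ℂ) := by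
      push_cast
      have e1 : ∀ x, (w x : ℂ) * ((‖W N b lam j (i0 + 3 ^ j * u) d x‖ : ℂ) ^ 2 *
        (‖W N b lam j (i0 + 3 ^ j * v) d x‖ : ℂ) ^ 2) =
        ∑ a ∈ range (3 ^ (N - d)), ∑ c ∈ range (3 ^ (N - d)),
        ∑ a' ∈ range (3 ^ (N - d)), ∑ c' ∈ range (3 ^ (N - d)),
          (w x : ℂ) * (A a x * B c x * (conj (A a' x) * conj (B c' x))) := by
        intro x
        rw [← Complex.mul_conj', ← Complex.mul_conj', mul_mul_mul_comm]
        simp only [W, map_sum]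
        rw [Finset.sum_mul_sum, Finset.sum_mul_sum, Finset.sum_mul, Finset.mul_sum]
        refine Finset.sum_congr rfl fun a _ => ?_
        rw [Finset.sum_mul, Finset.mul_sum]
        refine Finset.sum_congr rfl fun c _ => ?_
        rw [Finset.mul_sum, Finset.mul_sum]
        refine Finset.sum_congr rfl fun a' _ => ?_
        rw [Finset.mul_sum, Finset.mul_sum]
      simp_rw [e1]
      rw [Finset.sum_comm]
      refine Finset.sum_congr rfl fun a ha => ?_
      rw [Finset.sum_comm]
      refine Finset.sum_congr rfl fun c hc => ?_
      have hz : ∀ a' ∈ range (3 ^ (N - d)), ∀ c' ∈ range (3 ^ (N - d)), ¬ (a = a' ∧ c = c') →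
        ∑ x, (w x : ℂ) * (A a x * B c x * (conj (A a' x) * conj (B c' x))) = 0 := by
        intro a' ha' c' hc' hne
        simp only [hA, hB]
        by_cases h1 : a % 3 ^ (j + 1) = i0 + 3 ^ j * u
        swap
        · simp [h1]
        by_cases h2 : a' % 3 ^ (j + 1) = i0 + 3 ^ j * u
        swap
        · simp [h2]
        by_cases h3 : c % 3 ^ (j + 1) = i0 + 3 ^ j * v
        swap
        · simp [h3]
        by_cases h4 : c' % 3 ^ (j + 1) = i0 + 3 ^ j * v
        swap
        · simp [h4]
        simp only [h1, h2, h3, h4, if_true]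
        exact quad_zero N b lam j i0 hi0 u v hu hv huv d hd w hw a a' c c' (by simpa using ha)
          (by simpa using ha') (by simpa using hc) (by simpa using hc') h1 h2 h3 h4 hne
      rw [Finset.sum_comm, Finset.sum_eq_single_of_mem a ha, Finset.sum_comm,
        Finset.sum_eq_single_of_mem c hc]
      · refine Finset.sum_congr rfl fun x _ => ?_
        rw [← Complex.mul_conj', ← Complex.mul_conj']
        ring
      · intro c' hc' hne
        exact hz a ha c' hc' (fun h => hne h.2.symm)
      · intro a' ha' hne
        rw [Finset.sum_comm]
        refine Finset.sum_eq_zero fun c' hc' => ?_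
        exact hz a' ha' c' hc' (fun h => hne h.1.symm)
    exact_mod_cast this
  rw [key]
  have e2 : ∑ a ∈ range (3 ^ (N - d)), ∑ c ∈ range (3 ^ (N - d)),
        ∑ x, w x * (‖A a x‖ ^ 2 * ‖B c x‖ ^ 2) =
      ∑ x, w x * ((∑ a ∈ range (3 ^ (N - d)), ‖A a x‖ ^ 2) *
        (∑ c ∈ range (3 ^ (N - d)), ‖B c x‖ ^ 2)) := by
    simp_rw [Finset.sum_mul_sum, Finset.mul_sum]
    rw [Finset.sum_comm (s := univ)]
    refine Finset.sum_congr rfl fun a _ => ?_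
    rw [Finset.sum_comm]
  rw [e2]
  refine Finset.sum_le_sum fun x _ => mul_le_mul_of_nonneg_left ?_ (hw0 x)
  rw [sq]
  have hAg : ∑ a ∈ range (3 ^ (N - d)), ‖A a x‖ ^ 2 ≤ g N b lam d x := by
    refine Finset.sum_le_sum fun a _ => ?_
    simp only [hA]; split_ifs
    · exact le_rfl
    · simp
  have hBg : ∑ a ∈ range (3 ^ (N - d)), ‖B a x‖ ^ 2 ≤ g N b lam d x := by
    refine Finset.sum_le_sum fun a _ => ?_
    simp only [hB]; split_ifs
    · exact le_rfl
    · simp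
  exact mul_le_mul hAg hBg (by positivity) (g_nonneg _ _ _ _ _)

lemma g_inv (N : ℕ) (b : ℕ → ℂ) (lam : ℝ) (j i0 : ℕ) (hb : ∀ n, n % 3 ^ j ≠ i0 → b n = 0)
    (k d : ℕ) (hd : d + j ≤ N) (hk : k ≤ N - d) (h1 h2 : ℤ) (hA : Adm N j i0 k h1 h2) (x : Xs N) :
    g N b lam d (x + tv N h1 h2) = g N b lam d x := by
  unfold g
  refine Finset.sum_congr rfl fun c _ => ?_
  by_cases hc : c % 3 ^ j = i0
  · rw [G_cov N b lam d (by omega) c h1 h2 (hA c hc _ hk), norm_mul, ec_norm, one_mul]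
  · rw [G_supp N b lam j i0 hb d hd c hc, G_supp N b lam j i0 hb d hd c hc]

end DRP

namespace DRP
open Finset ComplexConjugate

/-- sum over a residue class -/
noncomputable def fc (N : ℕ) (b : ℕ → ℂ) (j c : ℕ) (x : Xs N) : ℂ :=
  ∑ n ∈ range (3 ^ N), if n % 3 ^ j = c then pf N b n x else 0

lemma W_zero (N : ℕ) (b : ℕ → ℂ) (lam : ℝ) (j cls : ℕ) (x : Xs N) :
    W N b lam j cls 0 x = fc N b (j + 1) cls x := by
  simp [W, fc, G]

open Classical in
/-- stopping indicator -/
noncomputable def st (N : ℕ) (b : ℕ → ℂ) (lam : ℝ) (d : ℕ) (x : Xs N) : ℝ :=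
  if (2 * rr N b < g N b lam d x ∧ ∀ d' < d, g N b lam d' x ≤ 2 * rr N b) then 1 else 0

lemma st_nonneg (N : ℕ) (b : ℕ → ℂ) (lam : ℝ) (d : ℕ) (x : Xs N) : 0 ≤ st N b lam d x := by
  unfold st; split_ifs <;> simp

lemma st_sum_le (N : ℕ) (b : ℕ → ℂ) (lam : ℝ) (n : ℕ) (x : Xs N) :
    ∑ d ∈ range n, st N b lam d x ≤ 1 := by
  by_cases h : ∃ d ∈ range n, st N b lam d x ≠ 0
  · obtain ⟨d, hd, hne⟩ := h
    rw [Finset.sum_eq_single_of_mem d hd]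
    · unfold st; split_ifs <;> simp
    · intro d' _ hdd
      unfold st at hne ⊢
      rw [if_neg]
      intro hd'
      split_ifs at hne with h0
      · rcases lt_trichotomy d d' with hlt | heq | hlt
        · linarith [hd'.2 d hlt, h0.1]
        · exact hdd heq.symm
        · linarith [h0.2 d' hlt, hd'.1]
      · exact hne rfl
  · push Not at h
    rw [Finset.sum_eq_zero h]; simp

lemma st_g_sq (N : ℕ) (b : ℕ → ℂ) (lam : ℝ) (d : ℕ) (hd : d ≤ N) (x : Xs N) :
    st N b lam d x * (g N b lam d x) ^ 2 ≤
      st N b lam d x * (4 * N * ∑ d' ∈ range N, (hh N b lam d' x) ^ 2) := by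
  unfold st
  split_ifs with h
  swap
  · simp
  rw [one_mul, one_mul]
  have h1 := g_le_sum N b lam x d hd
  set S := ∑ d' ∈ range d, hh N b lam d' x with hS
  have h2 : g N b lam d x ≤ 2 * S := by linarith [h.1]
  have h3 : (g N b lam d x) ^ 2 ≤ (2 * S) ^ 2 := pow_le_pow_left₀ (g_nonneg _ _ _ _ _) h2 2
  have h4 : S ^ 2 ≤ d * ∑ d' ∈ range d, (hh N b lam d' x) ^ 2 := by
    have := sq_sum_le_card_mul_sum_sq (s := range d) (f := fun d' => hh N b lam d' x)
    simpa using this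
  have h5 : ∑ d' ∈ range d, (hh N b lam d' x) ^ 2 ≤ ∑ d' ∈ range N, (hh N b lam d' x) ^ 2 :=
    Finset.sum_le_sum_of_subset_of_nonneg (by simpa using hd) (fun _ _ _ => sq_nonneg _)
  have h6 : (d : ℝ) * ∑ d' ∈ range d, (hh N b lam d' x) ^ 2 ≤
      N * ∑ d' ∈ range N, (hh N b lam d' x) ^ 2 := by
    gcongr
  nlinarith

lemma W_top (N : ℕ) (b : ℕ → ℂ) (lam : ℝ) (j cls : ℕ) (hj : j + 1 ≤ N) (x : Xs N) :
    ‖W N b lam j cls (N - (j + 1)) x‖ ^ 2 ≤ g N b lam (N - (j + 1)) x := by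
  unfold W g
  have : N - (N - (j + 1)) = j + 1 := by omega
  rw [this]
  have e : ∀ c ∈ range (3 ^ (j + 1)), (if c % 3 ^ (j + 1) = cls then
      G N b lam (N - (j + 1)) c x else 0) = if cls = c then G N b lam (N - (j + 1)) c x else 0 := by
    intro c hc
    rw [Nat.mod_eq_of_lt (by simpa using hc)]
    simp only [eq_comm]
  rw [Finset.sum_congr rfl e, Finset.sum_ite_eq]
  split_ifs with h
  · exact Finset.single_le_sum (f := fun c => ‖G N b lam (N - (j + 1)) c x‖ ^ 2)
      (fun _ _ => by positivity) h
  · simp; positivity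

open Classical in
lemma level (N : ℕ) (b : ℕ → ℂ) (j i0 : ℕ) (hj : j + 1 ≤ N) (hi0 : i0 < 3 ^ j)
    (hb : ∀ n, n % 3 ^ j ≠ i0 → b n = 0) (u v : ℕ)
    (hu : u < 3) (hv : v < 3) (huv : u ≠ v) (β : ℝ) (hβ : 0 < β) (hr0 : 0 < rr N b)
    (hr : 8 * rr N b ≤ β ^ 2) :
    β ^ 6 * ∑ x, (if β < ‖fc N b (j + 1) (i0 + 3 ^ j * u) x‖ ∧
      β < ‖fc N b (j + 1) (i0 + 3 ^ j * v) x‖ then (1 : ℝ) else 0) ≤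
      12288 * N ^ 4 * rr N b ^ 3 * Fintype.card (Xs N) := by
  have hN : (0 : ℝ) < N := by exact_mod_cast (by omega : 0 < N)
  set r := rr N b with hrdef
  set lam : ℝ := 4 * N * r / β with hlam
  have hl : 0 < lam := by positivity
  have hclose : ∀ x cls d, d + (j + 1) ≤ N → (∀ d' < d, g N b lam d' x ≤ 2 * r) →
      β < ‖fc N b (j + 1) cls x‖ → β / 2 < ‖W N b lam j cls d x‖ := by
    intro x cls d hd hg hf
    have h1 := W_far N b lam hl j cls x (2 * r) d hd hg
    rw [W_zero] at h1
    have h2 : (d : ℝ) * (2 * r / lam) ≤ β / 2 := by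
      have hdN : (d : ℝ) ≤ N := by exact_mod_cast (by omega : d ≤ N)
      have : 2 * r / lam = β / (2 * N) := by
        rw [hlam]; field_simp; norm_num
      rw [this, mul_div_assoc', div_le_div_iff₀ (by positivity) (by positivity)]
      nlinarith
    have h3 := norm_sub_norm_le (fc N b (j + 1) cls x) (W N b lam j cls d x)
    linarith
  have hpt : ∀ x, β ^ 4 / 16 * (if β < ‖fc N b (j + 1) (i0 + 3 ^ j * u) x‖ ∧
      β < ‖fc N b (j + 1) (i0 + 3 ^ j * v) x‖ then (1 : ℝ) else 0) ≤
      ∑ d ∈ range (N - j), st N b lam d x * (‖W N b lam j (i0 + 3 ^ j * u) d x‖ ^ 2 *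
        ‖W N b lam j (i0 + 3 ^ j * v) d x‖ ^ 2) := by
    intro x
    have hnn : ∀ d ∈ range (N - j), 0 ≤ st N b lam d x * (‖W N b lam j (i0 + 3 ^ j * u) d x‖ ^ 2 *
        ‖W N b lam j (i0 + 3 ^ j * v) d x‖ ^ 2) := by
      intro d _
      have := st_nonneg N b lam d x
      positivity
    split_ifs with hU
    swap
    · rw [mul_zero]; exact Finset.sum_nonneg hnn
    have hex : ∃ d, d < N - j ∧ 2 * r < g N b lam d x := by
      by_contra hcon
      push Not at hcon
      have h1 := hclose x (i0 + 3 ^ j * u) (N - (j + 1)) (by omega)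
        (fun d' hd' => hcon d' (by omega)) hU.1
      have h2 := W_top N b lam j (i0 + 3 ^ j * u) hj x
      have h3 := hcon (N - (j + 1)) (by omega)
      have h4 : (β / 2) ^ 2 < ‖W N b lam j (i0 + 3 ^ j * u) (N - (j + 1)) x‖ ^ 2 :=
        pow_lt_pow_left₀ h1 (by positivity) (by norm_num)
      nlinarith
    obtain ⟨hd1, hd2⟩ := Nat.find_spec hex
    have hmin : ∀ d' < Nat.find hex, g N b lam d' x ≤ 2 * r := by
      intro d' hd'
      have := Nat.find_min hex hd'
      by_contra hlt
      push Not at hlt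
      exact this ⟨by omega, hlt⟩
    set d := Nat.find hex
    refine le_trans ?_ (Finset.single_le_sum hnn (Finset.mem_range.2 hd1))
    have hst : st N b lam d x = 1 := by
      unfold st; rw [if_pos ⟨hd2, hmin⟩]
    rw [hst, one_mul, mul_one]
    have h1 := hclose x (i0 + 3 ^ j * u) d (by omega) hmin hU.1
    have h2 := hclose x (i0 + 3 ^ j * v) d (by omega) hmin hU.2
    have h1' := pow_le_pow_left₀ (by positivity) h1.le 2
    have h2' := pow_le_pow_left₀ (by positivity) h2.le 2
    calc β ^ 4 / 16 = (β / 2) ^ 2 * (β / 2) ^ 2 := by ring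
      _ ≤ _ := mul_le_mul h1' h2' (by positivity) (by positivity)
  have hsum : β ^ 4 / 16 * ∑ x, (if β < ‖fc N b (j + 1) (i0 + 3 ^ j * u) x‖ ∧
      β < ‖fc N b (j + 1) (i0 + 3 ^ j * v) x‖ then (1 : ℝ) else 0) ≤
      4 * N * (N * (12 * lam ^ 2 * (Fintype.card (Xs N) * r))) := by
    rw [Finset.mul_sum]
    calc _ ≤ ∑ x, ∑ d ∈ range (N - j), st N b lam d x * (‖W N b lam j (i0 + 3 ^ j * u) d x‖ ^ 2 *
        ‖W N b lam j (i0 + 3 ^ j * v) d x‖ ^ 2) := Finset.sum_le_sum fun x _ => hpt x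
      _ = ∑ d ∈ range (N - j), ∑ x, st N b lam d x * (‖W N b lam j (i0 + 3 ^ j * u) d x‖ ^ 2 *
        ‖W N b lam j (i0 + 3 ^ j * v) d x‖ ^ 2) := Finset.sum_comm
      _ ≤ ∑ d ∈ range (N - j), ∑ x, st N b lam d x * (g N b lam d x) ^ 2 := by
        refine Finset.sum_le_sum fun d hd => ?_
        rw [Finset.mem_range] at hd
        refine bil N b lam j i0 hi0 u v hu hv huv d (by omega) _ (st_nonneg N b lam d) ?_
        intro h1 h2 hA x
        have hinv : ∀ d' ≤ d, g N b lam d' (x + tv N h1 h2) = g N b lam d' x := fun d' hd' =>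
          g_inv N b lam j i0 hb (N - d) d' (by omega) (by omega) h1 h2 hA x
        unfold st
        congr 1
        rw [hinv d le_rfl]
        apply propext
        refine and_congr Iff.rfl (forall_congr' fun d' => ?_)
        refine imp_congr_right fun hd' => ?_
        rw [hinv d' hd'.le]
      _ ≤ ∑ d ∈ range (N - j), ∑ x, st N b lam d x *
          (4 * N * ∑ d' ∈ range N, (hh N b lam d' x) ^ 2) := by
        refine Finset.sum_le_sum fun d hd => Finset.sum_le_sum fun x _ => ?_
        rw [Finset.mem_range] at hd
        exact st_g_sq N b lam d (by omega) x
      _ = ∑ x, (∑ d ∈ range (N - j), st N b lam d x) *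
          (4 * N * ∑ d' ∈ range N, (hh N b lam d' x) ^ 2) := by
        rw [Finset.sum_comm]
        simp_rw [Finset.sum_mul]
      _ ≤ ∑ x, 1 * (4 * N * ∑ d' ∈ range N, (hh N b lam d' x) ^ 2) := by
        refine Finset.sum_le_sum fun x _ => ?_
        refine mul_le_mul_of_nonneg_right (st_sum_le _ _ _ _ _) (by positivity)
      _ = 4 * N * ∑ d' ∈ range N, ∑ x, (hh N b lam d' x) ^ 2 := by
        simp_rw [one_mul]
        rw [← Finset.mul_sum, Finset.sum_comm]
      _ ≤ 4 * N * ∑ d' ∈ range N, (12 * lam ^ 2 * (Fintype.card (Xs N) * r)) := by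
        gcongr with d' hd'
        exact high_lemma N b lam hl.le d' (by rw [Finset.mem_range] at hd'; omega)
      _ = _ := by rw [Finset.sum_const, Finset.card_range, nsmul_eq_mul]
  set T := ∑ x, (if β < ‖fc N b (j + 1) (i0 + 3 ^ j * u) x‖ ∧
      β < ‖fc N b (j + 1) (i0 + 3 ^ j * v) x‖ then (1 : ℝ) else 0)
  calc β ^ 6 * T = 16 * β ^ 2 * (β ^ 4 / 16 * T) := by ring
    _ ≤ 16 * β ^ 2 * (4 * N * (N * (12 * lam ^ 2 * (Fintype.card (Xs N) * r)))) := by gcongr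
    _ = _ := by rw [hlam]; field_simp; ring

lemma fc_sq_le (N : ℕ) (b : ℕ → ℂ) (j c : ℕ) (x : Xs N) :
    ‖fc N b j c x‖ ^ 2 ≤ 3 ^ N * rr N b := by
  unfold fc rr
  have h1 : ‖∑ n ∈ range (3 ^ N), if n % 3 ^ j = c then pf N b n x else 0‖ ≤
      ∑ n ∈ range (3 ^ N), ‖b n‖ := by
    refine (norm_sum_le _ _).trans (Finset.sum_le_sum fun n _ => ?_)
    split_ifs
    · rw [pf_norm]
    · simp
  have h2 := sq_sum_le_card_mul_sum_sq (s := range (3 ^ N)) (f := fun n => ‖b n‖)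
  have h3 := pow_le_pow_left₀ (norm_nonneg _) h1 2
  simp only [card_range] at h2
  push_cast at h2
  linarith

lemma dyadic_pt (N : ℕ) (r m : ℝ) (hr : 0 < r) (hm0 : 0 ≤ m) (hm : m ^ 2 ≤ 3 ^ N * r) (β0 : ℝ)
    (hβ0 : 0 < β0) (hβ : β0 ^ 2 = 8 * r) :
    m ^ 6 ≤ 512 * r ^ 3 + ∑ i ∈ range N, 64 * ((2 ^ i * β0) ^ 6 * if 2 ^ i * β0 < m then 1 else 0) := by
  have hnn : ∀ i ∈ range N, 0 ≤ 64 * ((2 ^ i * β0) ^ 6 * if 2 ^ i * β0 < m then (1 : ℝ) else 0) := by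
    intro i _
    split_ifs <;> positivity
  by_cases h : m ≤ β0
  · have h1 : m ^ 6 ≤ β0 ^ 6 := pow_le_pow_left₀ hm0 h 6
    have h2 : β0 ^ 6 = 512 * r ^ 3 := by
      calc β0 ^ 6 = (β0 ^ 2) ^ 3 := by ring
        _ = _ := by rw [hβ]; ring
    have := Finset.sum_nonneg hnn
    linarith
  · push Not at h
    -- first i with m ≤ 2^(i+1) β0
    have hex : ∃ i, m ≤ 2 ^ (i + 1) * β0 := by
      obtain ⟨i, hi⟩ := pow_unbounded_of_one_lt (m / β0) (by norm_num : (1 : ℝ) < 2)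
      refine ⟨i, ?_⟩
      rw [div_lt_iff₀ hβ0] at hi
      rw [pow_succ]
      nlinarith [pow_pos (by norm_num : (0 : ℝ) < 2) i]
    have hi1 := Nat.find_spec hex
    have hmin : ∀ i' < Nat.find hex, ¬ m ≤ 2 ^ (i' + 1) * β0 := fun i' hi' => Nat.find_min hex hi'
    set i := Nat.find hex
    have hi2 : 2 ^ i * β0 < m := by
      rcases Nat.eq_zero_or_pos i with h0 | h0
      · rw [h0]; simpa using h
      · have := hmin (i - 1) (by omega)
        rw [Nat.sub_add_cancel h0] at this
        push Not at this; exact this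
    have hiN : i < N := by
      by_contra hcon
      push Not at hcon
      have h3 : (2 ^ i * β0) ^ 2 < m ^ 2 := pow_lt_pow_left₀ hi2 (by positivity) (by norm_num)
      have h4 : (3 : ℝ) ^ N ≤ 4 ^ N := pow_le_pow_left₀ (by norm_num) (by norm_num) N
      have h5 : (4 : ℝ) ^ N ≤ 4 ^ i := pow_le_pow_right₀ (by norm_num) hcon
      have h6 : (2 ^ i * β0) ^ 2 = 4 ^ i * (8 * r) := by
        rw [mul_pow, hβ, ← pow_mul, mul_comm i 2, pow_mul]; norm_num
      have h7 : (3 : ℝ) ^ N * r ≤ 4 ^ i * r := by gcongr; linarith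
      have h8 : (0 : ℝ) < 4 ^ i * r := by positivity
      nlinarith
    have h9 := Finset.single_le_sum hnn (Finset.mem_range.2 hiN)
    rw [if_pos hi2, mul_one] at h9
    have h10 : m ^ 6 ≤ 64 * (2 ^ i * β0) ^ 6 := by
      calc m ^ 6 ≤ (2 ^ (i + 1) * β0) ^ 6 := pow_le_pow_left₀ hm0 hi1 6
        _ = _ := by rw [pow_succ]; ring
    have : 0 ≤ 512 * r ^ 3 := by positivity
    linarith

lemma bil_six (N : ℕ) (b : ℕ → ℂ) (j i0 : ℕ) (hj : j + 1 ≤ N) (hi0 : i0 < 3 ^ j)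
    (hb : ∀ n, n % 3 ^ j ≠ i0 → b n = 0) (u v : ℕ)
    (hu : u < 3) (hv : v < 3) (huv : u ≠ v) (hr0 : 0 < rr N b) :
    ∑ x, (min ‖fc N b (j + 1) (i0 + 3 ^ j * u) x‖ ‖fc N b (j + 1) (i0 + 3 ^ j * v) x‖) ^ 6 ≤
      800000 * N ^ 5 * rr N b ^ 3 * Fintype.card (Xs N) := by
  set r := rr N b with hr
  set β0 := Real.sqrt (8 * r) with hβ0
  have hβpos : 0 < β0 := Real.sqrt_pos.2 (by positivity)
  have hβsq : β0 ^ 2 = 8 * r := Real.sq_sqrt (by positivity)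
  have hN : (1 : ℝ) ≤ N := by exact_mod_cast (by omega : 1 ≤ N)
  calc _ ≤ ∑ x : Xs N, (512 * r ^ 3 + ∑ i ∈ range N, 64 * ((2 ^ i * β0) ^ 6 *
        if 2 ^ i * β0 < min ‖fc N b (j + 1) (i0 + 3 ^ j * u) x‖
          ‖fc N b (j + 1) (i0 + 3 ^ j * v) x‖ then (1 : ℝ) else 0)) := by
        refine Finset.sum_le_sum fun x _ => ?_
        refine dyadic_pt N r _ hr0 (by positivity) ?_ β0 hβpos hβsq
        refine le_trans ?_ (fc_sq_le N b (j + 1) (i0 + 3 ^ j * u) x)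
        exact pow_le_pow_left₀ (by positivity) (min_le_left _ _) 2
    _ = Fintype.card (Xs N) * (512 * r ^ 3) + ∑ i ∈ range N, 64 * ((2 ^ i * β0) ^ 6 * ∑ x,
        if 2 ^ i * β0 < ‖fc N b (j + 1) (i0 + 3 ^ j * u) x‖ ∧
          2 ^ i * β0 < ‖fc N b (j + 1) (i0 + 3 ^ j * v) x‖ then (1 : ℝ) else 0) := by
        rw [Finset.sum_add_distrib, Finset.sum_comm (s := univ)]
        simp only [lt_min_iff, Finset.mul_sum]
        simp
    _ ≤ Fintype.card (Xs N) * (512 * r ^ 3) + ∑ i ∈ range N,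
        64 * (12288 * N ^ 4 * r ^ 3 * Fintype.card (Xs N)) := by
        refine add_le_add le_rfl (Finset.sum_le_sum fun i hi => mul_le_mul_of_nonneg_left ?_ (by norm_num))
        have h1 : (1 : ℝ) ≤ 2 ^ i := one_le_pow₀ (by norm_num)
        have := level N b j i0 hj hi0 hb u v hu hv huv (2 ^ i * β0) (by positivity) hr0 (by
          rw [mul_pow, hβsq]
          have : (1 : ℝ) ≤ (2 ^ i) ^ 2 := one_le_pow₀ h1
          nlinarith)
        convert this using 3
    _ ≤ _ := by
        rw [Finset.sum_const, Finset.card_range, nsmul_eq_mul]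
        have h5 : (1 : ℝ) ≤ N ^ 5 := one_le_pow₀ hN
        have hc : (0 : ℝ) ≤ r ^ 3 * Fintype.card (Xs N) := by positivity
        have : r ^ 3 * Fintype.card (Xs N) ≤ N ^ 5 * (r ^ 3 * Fintype.card (Xs N)) :=
          le_mul_of_one_le_left hc h5
        nlinarith

end DRP

namespace DRP
open Finset ComplexConjugate

lemma bn_real (N : ℝ) (hN : 1 ≤ N) (A B C s : ℝ) (hC : 0 ≤ C) (hBC : C ≤ B) (hAB : B ≤ A)
    (hs0 : 0 ≤ s) (hs : s ≤ A + B + C) :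
    s ^ 6 ≤ (1 + 1 / N) ^ 6 * (A ^ 6 + B ^ 6 + C ^ 6) + (4 * N) ^ 6 * B ^ 6 := by
  have hN0 : 0 < N := by linarith
  have hB : 0 ≤ B := by linarith
  have hA : 0 ≤ A := by linarith
  rcases le_or_gt B (A / (2 * N)) with h | h
  · have h1 : s ≤ (1 + 1 / N) * A := by
      have : A / (2 * N) + A / (2 * N) = 1 / N * A := by field_simp; ring
      nlinarith
    calc s ^ 6 ≤ ((1 + 1 / N) * A) ^ 6 := pow_le_pow_left₀ hs0 h1 6
      _ = (1 + 1 / N) ^ 6 * A ^ 6 := by rw [mul_pow]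
      _ ≤ (1 + 1 / N) ^ 6 * (A ^ 6 + B ^ 6 + C ^ 6) := by
          gcongr
          have := pow_nonneg hB 6
          have := pow_nonneg hC 6
          linarith
      _ ≤ _ := by
          have : 0 ≤ (4 * N) ^ 6 * B ^ 6 := by positivity
          linarith
  · rw [div_lt_iff₀ (by positivity)] at h
    have h1 : s ≤ 4 * N * B := by nlinarith
    have h2 : s ^ 6 ≤ (4 * N * B) ^ 6 := pow_le_pow_left₀ hs0 h1 6
    rw [mul_pow (4 * N)] at h2
    have : 0 ≤ (1 + 1 / N) ^ 6 * (A ^ 6 + B ^ 6 + C ^ 6) := by positivity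
    linarith

lemma bn_pt (N : ℝ) (hN : 1 ≤ N) (z0 z1 z2 : ℂ) :
    ‖z0 + z1 + z2‖ ^ 6 ≤ (1 + 1 / N) ^ 6 * (‖z0‖ ^ 6 + ‖z1‖ ^ 6 + ‖z2‖ ^ 6) +
      (4 * N) ^ 6 * (min ‖z0‖ ‖z1‖ ^ 6 + min ‖z0‖ ‖z2‖ ^ 6 + min ‖z1‖ ‖z2‖ ^ 6) := by
  have ht : ‖z0 + z1 + z2‖ ≤ ‖z0‖ + ‖z1‖ + ‖z2‖ := norm_add₃_le
  have hs0 := norm_nonneg (z0 + z1 + z2)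
  have h0 := norm_nonneg z0
  have h1 := norm_nonneg z1
  have h2 := norm_nonneg z2
  generalize ‖z0 + z1 + z2‖ = s at *
  generalize ‖z0‖ = a at *
  generalize ‖z1‖ = b at *
  generalize ‖z2‖ = c at *
  have key : ∀ B, (B ^ 6 ≤ min a b ^ 6 + min a c ^ 6 + min b c ^ 6) →
      s ^ 6 ≤ (1 + 1 / N) ^ 6 * (a ^ 6 + b ^ 6 + c ^ 6) + (4 * N) ^ 6 * B ^ 6 →
      s ^ 6 ≤ (1 + 1 / N) ^ 6 * (a ^ 6 + b ^ 6 + c ^ 6) +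
      (4 * N) ^ 6 * (min a b ^ 6 + min a c ^ 6 + min b c ^ 6) := by
    intro B h h'
    refine h'.trans ?_
    gcongr
  have m1 : 0 ≤ min a b ^ 6 := by positivity
  have m2 : 0 ≤ min a c ^ 6 := by positivity
  have m3 : 0 ≤ min b c ^ 6 := by positivity
  rcases le_total a b with hab | hab <;> rcases le_total a c with hac | hac <;>
    rcases le_total b c with hbc | hbc
  · refine key b (by rw [min_eq_left hbc] at *; linarith) ?_
    have := bn_real N hN c b a s h0 hab hbc hs0 (by linarith)
    linarith
  · refine key c (by rw [min_eq_right hbc] at *; linarith) ?_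
    have := bn_real N hN b c a s h0 hac hbc hs0 (by linarith)
    linarith
  · refine key c (by rw [min_eq_right hac] at *; linarith) ?_
    have := bn_real N hN a c b s h1 (by linarith) hac hs0 (by linarith)
    linarith
  · refine key a (by rw [min_eq_left hab] at *; linarith) ?_
    have := bn_real N hN b a c s h2 hac hab hs0 (by linarith)
    linarith
  · refine key a (by rw [min_eq_left hac] at *; linarith) ?_
    have := bn_real N hN c a b s h1 hab hac hs0 (by linarith)
    linarith
  · refine key a (by rw [min_eq_left hac] at *; linarith) ?_
    have := bn_real N hN c a b s h1 hab hac hs0 (by linarith)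
    linarith
  · refine key c (by rw [min_eq_right hac] at *; linarith) ?_
    have := bn_real N hN a c b s h1 hbc hac hs0 (by linarith)
    linarith
  · refine key b (by rw [min_eq_right hab] at *; linarith) ?_
    have := bn_real N hN a b c s h2 hbc hab hs0 (by linarith)
    linarith

lemma mod_split (j n : ℕ) : n % 3 ^ (j + 1) = n % 3 ^ j + 3 ^ j * (n / 3 ^ j % 3) := by
  rw [pow_succ, Nat.mod_mul]

lemma fc_split (N : ℕ) (b : ℕ → ℂ) (j c : ℕ) (hc : c < 3 ^ j) (x : Xs N) :
    fc N b j c x = fc N b (j + 1) (c + 3 ^ j * 0) x + fc N b (j + 1) (c + 3 ^ j * 1) x +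
      fc N b (j + 1) (c + 3 ^ j * 2) x := by
  unfold fc
  rw [← Finset.sum_add_distrib, ← Finset.sum_add_distrib]
  refine Finset.sum_congr rfl fun n _ => ?_
  have hP : 0 < 3 ^ j := by positivity
  have hiff : ∀ i, n % 3 ^ (j + 1) = c + 3 ^ j * i ↔ (n % 3 ^ j = c ∧ n / 3 ^ j % 3 = i) := by
    intro i
    constructor
    · intro h
      have h1 := class_mod j c i n hc h
      rw [mod_split, h1] at h
      exact ⟨h1, Nat.eq_of_mul_eq_mul_left hP (Nat.add_left_cancel h)⟩
    · rintro ⟨h1, h2⟩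
      rw [mod_split, h1, h2]
  simp only [hiff]
  have h3 : n / 3 ^ j % 3 = 0 ∨ n / 3 ^ j % 3 = 1 ∨ n / 3 ^ j % 3 = 2 := by omega
  by_cases h : n % 3 ^ j = c
  · rcases h3 with h3 | h3 | h3 <;> simp [h, h3]
  · simp [h]

noncomputable def res (b : ℕ → ℂ) (j c : ℕ) (n : ℕ) : ℂ := if n % 3 ^ j = c then b n else 0

lemma fc_res (N : ℕ) (b : ℕ → ℂ) (j c : ℕ) (hc : c < 3 ^ j) (u : ℕ) (x : Xs N) :
    fc N (res b j c) (j + 1) (c + 3 ^ j * u) x = fc N b (j + 1) (c + 3 ^ j * u) x := by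
  unfold fc
  refine Finset.sum_congr rfl fun n _ => ?_
  split_ifs with h
  · simp [pf, res, class_mod j c u n hc h]
  · rfl

lemma sum_rr_res (N : ℕ) (b : ℕ → ℂ) (j : ℕ) :
    ∑ c ∈ range (3 ^ j), rr N (res b j c) = rr N b := by
  unfold rr
  rw [Finset.sum_comm]
  refine Finset.sum_congr rfl fun n _ => ?_
  have : ∀ c, ‖res b j c n‖ ^ 2 = if n % 3 ^ j = c then ‖b n‖ ^ 2 else 0 := by
    intro c; unfold res; split_ifs <;> simp
  simp only [this]
  rw [Finset.sum_ite_eq, if_pos]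
  exact Finset.mem_range.2 (Nat.mod_lt _ (by positivity))

lemma rr_nonneg (N : ℕ) (b : ℕ → ℂ) : 0 ≤ rr N b := Finset.sum_nonneg fun _ _ => by positivity

lemma sum_cube_le {ι : Type*} (s : Finset ι) (f : ι → ℝ) (hf : ∀ i ∈ s, 0 ≤ f i) :
    ∑ i ∈ s, f i ^ 3 ≤ (∑ i ∈ s, f i) ^ 3 := by
  calc ∑ i ∈ s, f i ^ 3 ≤ ∑ i ∈ s, f i * (∑ i ∈ s, f i) ^ 2 := by
        refine Finset.sum_le_sum fun i hi => ?_
        have h1 := Finset.single_le_sum hf hi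
        have h2 := pow_le_pow_left₀ (hf i hi) h1 2
        have := mul_le_mul_of_nonneg_left h2 (hf i hi)
        nlinarith
    _ = _ := by rw [← Finset.sum_mul]; ring

lemma bil_res (N : ℕ) (b : ℕ → ℂ) (j c : ℕ) (hj : j + 1 ≤ N) (hc : c < 3 ^ j) (u v : ℕ)
    (hu : u < 3) (hv : v < 3) (huv : u ≠ v) :
    ∑ x, (min ‖fc N b (j + 1) (c + 3 ^ j * u) x‖ ‖fc N b (j + 1) (c + 3 ^ j * v) x‖) ^ 6 ≤
      800000 * N ^ 5 * rr N (res b j c) ^ 3 * Fintype.card (Xs N) := by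
  rcases (rr_nonneg N (res b j c)).eq_or_lt with h | h
  · have hz : ∀ x, fc N b (j + 1) (c + 3 ^ j * u) x = 0 := by
      intro x
      rw [← fc_res N b j c hc]
      have h1 := fc_sq_le N (res b j c) (j + 1) (c + 3 ^ j * u) x
      rw [← h, mul_zero] at h1
      have : ‖fc N (res b j c) (j + 1) (c + 3 ^ j * u) x‖ ^ 2 = 0 := le_antisymm h1 (by positivity)
      simpa using this
    rw [← h]
    simp [hz]
  · have := bil_six N (res b j c) j c hj hc (fun n hn => by simp [res, hn]) u v hu hv huv h
    simpa only [fc_res N b j c hc] using this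

noncomputable def Tj (N : ℕ) (b : ℕ → ℂ) (j : ℕ) : ℝ :=
  ∑ c ∈ range (3 ^ j), ∑ x, ‖fc N b j c x‖ ^ 6

lemma Tj_step (N : ℕ) (b : ℕ → ℂ) (j : ℕ) (hj : j + 1 ≤ N) :
    Tj N b j ≤ (1 + 1 / (N : ℝ)) ^ 6 * Tj N b (j + 1) +
      (4 * (N : ℝ)) ^ 6 * (2400000 * N ^ 5 * rr N b ^ 3 * Fintype.card (Xs N)) := by
  have hN : (1 : ℝ) ≤ N := by exact_mod_cast (by omega : 1 ≤ N)
  have hc : ∀ c ∈ range (3 ^ j), ∑ x, ‖fc N b j c x‖ ^ 6 ≤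
      (1 + 1 / (N : ℝ)) ^ 6 * ∑ i ∈ range 3, ∑ x, ‖fc N b (j + 1) (c + 3 ^ j * i) x‖ ^ 6 +
      (4 * (N : ℝ)) ^ 6 * (2400000 * N ^ 5 * rr N (res b j c) ^ 3 * Fintype.card (Xs N)) := by
    intro c hc
    rw [Finset.mem_range] at hc
    have h01 := bil_res N b j c hj hc 0 1 (by norm_num) (by norm_num) (by norm_num)
    have h02 := bil_res N b j c hj hc 0 2 (by norm_num) (by norm_num) (by norm_num)
    have h12 := bil_res N b j c hj hc 1 2 (by norm_num) (by norm_num) (by norm_num)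
    have hpt := fun x => bn_pt N hN (fc N b (j + 1) (c + 3 ^ j * 0) x)
      (fc N b (j + 1) (c + 3 ^ j * 1) x) (fc N b (j + 1) (c + 3 ^ j * 2) x)
    simp only [← fc_split N b j c hc] at hpt
    refine (Finset.sum_le_sum fun x _ => hpt x).trans ?_
    calc _ = (1 + 1 / (N : ℝ)) ^ 6 * ∑ i ∈ range 3, ∑ x, ‖fc N b (j + 1) (c + 3 ^ j * i) x‖ ^ 6 +
          (4 * (N : ℝ)) ^ 6 * (∑ x, (min ‖fc N b (j + 1) (c + 3 ^ j * 0) x‖ ‖fc N b (j + 1) (c + 3 ^ j * 1) x‖) ^ 6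
          + ∑ x, (min ‖fc N b (j + 1) (c + 3 ^ j * 0) x‖ ‖fc N b (j + 1) (c + 3 ^ j * 2) x‖) ^ 6
          + ∑ x, (min ‖fc N b (j + 1) (c + 3 ^ j * 1) x‖ ‖fc N b (j + 1) (c + 3 ^ j * 2) x‖) ^ 6) := by
          rw [Finset.sum_add_distrib, ← Finset.mul_sum, ← Finset.mul_sum]
          simp only [Finset.sum_add_distrib, Finset.sum_range_succ, Finset.sum_range_zero, zero_add]
      _ ≤ _ := by
          refine add_le_add le_rfl (mul_le_mul_of_nonneg_left ?_ (by positivity))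
          linarith
  unfold Tj
  rw [sum_range_three]
  refine (Finset.sum_le_sum hc).trans ?_
  rw [Finset.sum_add_distrib, ← Finset.mul_sum, ← Finset.mul_sum, ← Finset.sum_mul, ← Finset.mul_sum]
  have h3 := sum_cube_le (range (3 ^ j)) (fun c => rr N (res b j c)) (fun c _ => rr_nonneg _ _)
  rw [sum_rr_res] at h3
  gcongr

lemma Tj_top (N : ℕ) (b : ℕ → ℂ) : Tj N b N ≤ rr N b ^ 3 * Fintype.card (Xs N) := by
  have h1 : ∀ c ∈ range (3 ^ N), ∑ x, ‖fc N b N c x‖ ^ 6 = (‖b c‖ ^ 2) ^ 3 * Fintype.card (Xs N) := by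
    intro c hc
    have : ∀ x, fc N b N c x = pf N b c x := by
      intro x
      unfold fc
      rw [Finset.sum_eq_single c]
      · rw [if_pos (Nat.mod_eq_of_lt (Finset.mem_range.1 hc))]
      · intro n hn hne
        rw [if_neg]
        rwa [Nat.mod_eq_of_lt (Finset.mem_range.1 hn)]
      · intro h; exact absurd hc h
    simp only [this, pf_norm]
    rw [Finset.sum_const, Finset.card_univ, nsmul_eq_mul, mul_comm, ← pow_mul]
  unfold Tj
  rw [Finset.sum_congr rfl h1, ← Finset.sum_mul]
  gcongr
  exact sum_cube_le _ _ (fun i _ => by positivity)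

lemma Tj_iter (N : ℕ) (b : ℕ → ℂ) (k : ℕ) : k ≤ N →
    Tj N b (N - k) ≤ ((1 + 1 / (N : ℝ)) ^ 6) ^ k * (rr N b ^ 3 * Fintype.card (Xs N) +
      k * ((4 * (N : ℝ)) ^ 6 * (2400000 * N ^ 5 * rr N b ^ 3 * Fintype.card (Xs N)))) := by
  induction k with
  | zero => intro _; simpa using Tj_top N b
  | succ k ih =>
    intro hk
    have h1 := ih (by omega)
    have h2 := Tj_step N b (N - (k + 1)) (by omega)
    rw [show N - (k + 1) + 1 = N - k by omega] at h2
    have hr := rr_nonneg N b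
    set Q := (4 * (N : ℝ)) ^ 6 * (2400000 * N ^ 5 * rr N b ^ 3 * Fintype.card (Xs N)) with hQ
    have hQ0 : 0 ≤ Q := by positivity
    set P := (1 + 1 / (N : ℝ)) ^ 6 with hP
    have hP1 : 1 ≤ P := one_le_pow₀ (by
      have : (0 : ℝ) ≤ 1 / N := by positivity
      linarith)
    have hP2 : 1 ≤ P ^ (k + 1) := one_le_pow₀ hP1
    have h3 : P * Tj N b (N - k) ≤ P * (P ^ k * (rr N b ^ 3 * Fintype.card (Xs N) + k * Q)) :=
      mul_le_mul_of_nonneg_left h1 (by linarith)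
    have h4 : Q ≤ P ^ (k + 1) * Q := le_mul_of_one_le_left hQ0 hP2
    push_cast
    calc _ ≤ _ := h2
      _ ≤ P * (P ^ k * (rr N b ^ 3 * Fintype.card (Xs N) + k * Q)) + P ^ (k + 1) * Q := by linarith
      _ = _ := by ring

/-- the explicit constant -/
noncomputable def C0 : ℝ := Real.exp 6 * (1 + 4 ^ 6 * 2400000)

lemma C0_pos : 0 < C0 := by unfold C0; positivity

lemma finite_main (N : ℕ) (hN : 1 ≤ N) (b : ℕ → ℂ) :
    ∑ x : Xs N, ‖∑ n ∈ range (3 ^ N), pf N b n x‖ ^ 6 ≤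
      C0 * N ^ 12 * rr N b ^ 3 * Fintype.card (Xs N) := by
  have h := Tj_iter N b N le_rfl
  have h0 : Tj N b (N - N) = ∑ x : Xs N, ‖∑ n ∈ range (3 ^ N), pf N b n x‖ ^ 6 := by
    simp [Tj, fc, Nat.mod_one]
  rw [h0] at h
  have hN' : (1 : ℝ) ≤ N := by exact_mod_cast hN
  have hexp : ((1 + 1 / (N : ℝ)) ^ 6) ^ N ≤ Real.exp 6 := by
    have h1 : 1 + 1 / (N : ℝ) ≤ Real.exp (1 / N) := by
      rw [add_comm]; exact Real.add_one_le_exp _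
    calc ((1 + 1 / (N : ℝ)) ^ 6) ^ N ≤ ((Real.exp (1 / N)) ^ 6) ^ N := by gcongr
      _ = Real.exp 6 := by
        rw [← pow_mul, ← Real.exp_nat_mul]
        congr 1
        push_cast
        field_simp
  have hr := rr_nonneg N b
  have h12 : (1 : ℝ) ≤ N ^ 12 := one_le_pow₀ hN'
  have hX : 0 ≤ rr N b ^ 3 * Fintype.card (Xs N) := by positivity
  refine h.trans ?_
  calc _ ≤ Real.exp 6 * (N ^ 12 * (rr N b ^ 3 * Fintype.card (Xs N)) +
        N * ((4 * (N : ℝ)) ^ 6 * (2400000 * N ^ 5 * rr N b ^ 3 * Fintype.card (Xs N)))) := by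
        refine mul_le_mul hexp (add_le_add (le_mul_of_one_le_left hX h12) le_rfl) (by positivity)
          (by positivity)
    _ = _ := by unfold C0; ring

end DRP

namespace DRP
open Finset ComplexConjugate

noncomputable def ph (n : ℕ) (y : ℝ × ℝ) : ℂ := Complex.exp (2 * Real.pi * Complex.I *
                ((n : ℂ) * (y.1 : ℂ) + (n : ℂ) ^ 2 * (y.2 : ℂ)))

noncomputable def Phi (M : ℕ) (a : ℕ → ℂ) (y : ℝ × ℝ) : ℝ :=
  ‖∑ n ∈ Finset.Icc 1 M, a n * ph n y‖ ^ 6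

lemma ph_norm (n : ℕ) (y : ℝ × ℝ) : ‖ph n y‖ = 1 := by
  unfold ph
  have : (2 * Real.pi * Complex.I * ((n : ℂ) * (y.1 : ℂ) + (n : ℂ) ^ 2 * (y.2 : ℂ))) =
    ((2 * Real.pi * (n * y.1 + n ^ 2 * y.2) : ℝ) : ℂ) * Complex.I := by push_cast; ring
  rw [this, Complex.norm_exp_ofReal_mul_I]

lemma ph_add (n : ℕ) (y w : ℝ × ℝ) : ph n (y + w) = ph n y * ph n w := by
  unfold ph
  rw [← Complex.exp_add]
  congr 1
  simp only [Prod.fst_add, Prod.snd_add]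
  push_cast; ring

lemma ph_int (n : ℕ) (k l : ℤ) : ph n ((k : ℝ), (l : ℝ)) = 1 := by
  unfold ph
  rw [Complex.exp_eq_one_iff]
  exact ⟨n * k + n ^ 2 * l, by push_cast; ring⟩

lemma Phi_per (M : ℕ) (a : ℕ → ℂ) (y : ℝ × ℝ) (k l : ℤ) :
    Phi M a (y + ((k : ℝ), (l : ℝ))) = Phi M a y := by
  unfold Phi
  simp only [ph_add, ph_int, mul_one]

lemma Phi_cont (M : ℕ) (a : ℕ → ℂ) : Continuous (Phi M a) := by
  unfold Phi ph
  fun_prop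

lemma int_eq (Φ : ℝ × ℝ → ℝ) (hΦ : Continuous Φ) :
    ∫ y in Set.Icc (0 : ℝ) 1 ×ˢ Set.Icc (0 : ℝ) 1, Φ y = ∫ s in (0:ℝ)..1, ∫ t in (0:ℝ)..1, Φ (s, t) := by
  have hi : IntegrableOn Φ (Set.Icc (0 : ℝ) 1 ×ˢ Set.Icc (0 : ℝ) 1) (volume.prod volume) :=
    hΦ.continuousOn.integrableOn_compact (isCompact_Icc.prod isCompact_Icc)
  rw [Measure.volume_eq_prod, setIntegral_prod _ hi]
  simp only [intervalIntegral.integral_of_le zero_le_one, integral_Icc_eq_integral_Ioc]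

lemma int_shift (Φ : ℝ × ℝ → ℝ) (hΦ : Continuous Φ)
    (hp : ∀ (y : ℝ × ℝ) (k l : ℤ), Φ (y + ((k : ℝ), (l : ℝ))) = Φ y) (w : ℝ × ℝ) :
    ∫ y in Set.Icc (0 : ℝ) 1 ×ˢ Set.Icc (0 : ℝ) 1, Φ (y + w) =
      ∫ y in Set.Icc (0 : ℝ) 1 ×ˢ Set.Icc (0 : ℝ) 1, Φ y := by
  rw [int_eq Φ hΦ, int_eq (fun y => Φ (y + w)) (by fun_prop)]
  have h1 : ∀ s, ∫ t in (0:ℝ)..1, Φ ((s, t) + w) = ∫ t in (0:ℝ)..1, Φ (s + w.1, t) := by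
    intro s
    have hper : Function.Periodic (fun t => Φ (s + w.1, t)) 1 := by
      intro t
      have := hp (s + w.1, t) 0 1
      simpa using this
    have e1 := intervalIntegral.integral_comp_add_right (a := 0) (b := 1)
      (fun t => Φ (s + w.1, t)) w.2
    have e2 := hper.intervalIntegral_add_eq (0 + w.2) 0
    have e3 : ∀ t, (s, t) + w = (s + w.1, t + w.2) := fun t => rfl
    simp only [e3]
    rw [e1, show (1 : ℝ) + w.2 = 0 + w.2 + 1 by ring, e2, zero_add]
  simp only [h1]
  have hper : Function.Periodic (fun s => ∫ t in (0:ℝ)..1, Φ (s, t)) 1 := by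
    intro s
    refine intervalIntegral.integral_congr fun t _ => ?_
    have := hp (s, t) 1 0
    simpa using this
  have e1 := intervalIntegral.integral_comp_add_right (a := 0) (b := 1)
      (fun s => ∫ t in (0:ℝ)..1, Φ (s, t)) w.1
  have e2 := hper.intervalIntegral_add_eq (0 + w.1) 0
  rw [e1, show (1 : ℝ) + w.1 = 0 + w.1 + 1 by ring, e2, zero_add]

noncomputable def pt (N : ℕ) (x : Xs N) : ℝ × ℝ :=
  ((x.1.val : ℝ) / (3 ^ (2 * N) : ℕ), (x.2.val : ℝ) / (3 ^ (2 * N) : ℕ))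

lemma ph_pt (N n : ℕ) (x : Xs N) :
    ph n (pt N x) = ZMod.stdAddChar ((n : Rg N) * x.1 + (n : Rg N) ^ 2 * x.2) := by
  have h : (n : Rg N) * x.1 + (n : Rg N) ^ 2 * x.2 =
      ((n * x.1.val + n ^ 2 * x.2.val : ℤ) : Rg N) := by
    push_cast
    simp [ZMod.natCast_zmod_val]
  rw [h, ZMod.stdAddChar_coe]
  unfold ph pt
  congr 1
  push_cast
  ring

lemma sum_pt (N M : ℕ) (hN : 1 ≤ N) (hM : M < 3 ^ N) (a : ℕ → ℂ) (y : ℝ × ℝ) :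
    ∑ x : Xs N, Phi M a (y + pt N x) ≤
      C0 * N ^ 12 * (∑ n ∈ Finset.Icc 1 M, ‖a n‖ ^ 2) ^ 3 * Fintype.card (Xs N) := by
  set b : ℕ → ℂ := fun n => if n ∈ Finset.Icc 1 M then a n * ph n y else 0 with hb
  have hsub : Finset.Icc 1 M ⊆ range (3 ^ N) := by
    intro n hn
    rw [Finset.mem_Icc] at hn
    exact Finset.mem_range.2 (by omega)
  have h := finite_main N hN b
  have h1 : rr N b = ∑ n ∈ Finset.Icc 1 M, ‖a n‖ ^ 2 := by
    unfold rr
    rw [← Finset.sum_subset hsub]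
    · refine Finset.sum_congr rfl fun n hn => ?_
      simp only [hb, if_pos hn, norm_mul, ph_norm, mul_one]
    · intro n _ hn
      simp only [hb, if_neg hn]; simp
  rw [h1] at h
  refine le_trans (le_of_eq ?_) h
  refine Finset.sum_congr rfl fun x _ => ?_
  unfold Phi
  congr 2
  rw [← Finset.sum_subset hsub]
  · refine Finset.sum_congr rfl fun n hn => ?_
    simp only [pf, hb, if_pos hn]
    rw [ph_add, ph_pt, mul_assoc]
  · intro n _ hn
    simp only [pf, hb, if_neg hn]; simp

lemma int_main (N M : ℕ) (hN : 1 ≤ N) (hM : M < 3 ^ N) (a : ℕ → ℂ) :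
    ∫ y in Set.Icc (0 : ℝ) 1 ×ˢ Set.Icc (0 : ℝ) 1, Phi M a y ≤
      C0 * N ^ 12 * (∑ n ∈ Finset.Icc 1 M, ‖a n‖ ^ 2) ^ 3 := by
  have hK : IsCompact (Set.Icc (0 : ℝ) 1 ×ˢ Set.Icc (0 : ℝ) 1) := isCompact_Icc.prod isCompact_Icc
  have hc := Phi_cont M a
  have hi : ∀ x : Xs N, IntegrableOn (fun y => Phi M a (y + pt N x))
      (Set.Icc (0 : ℝ) 1 ×ˢ Set.Icc (0 : ℝ) 1) := fun x =>
    (by fun_prop : Continuous fun y => Phi M a (y + pt N x)).continuousOn.integrableOn_compact hK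
  set K := C0 * N ^ 12 * (∑ n ∈ Finset.Icc 1 M, ‖a n‖ ^ 2) ^ 3 with hKdef
  have hcard : (0 : ℝ) < Fintype.card (Xs N) := by
    exact_mod_cast Fintype.card_pos
  have e1 : ∫ y in Set.Icc (0 : ℝ) 1 ×ˢ Set.Icc (0 : ℝ) 1, ∑ x : Xs N, Phi M a (y + pt N x) =
      Fintype.card (Xs N) * ∫ y in Set.Icc (0 : ℝ) 1 ×ˢ Set.Icc (0 : ℝ) 1, Phi M a y := by
    rw [integral_finsetSum _ (fun x _ => hi x)]
    simp only [int_shift (Phi M a) hc (Phi_per M a)]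
    rw [Finset.sum_const, Finset.card_univ, nsmul_eq_mul]
  have e2 : ∫ y in Set.Icc (0 : ℝ) 1 ×ˢ Set.Icc (0 : ℝ) 1, ∑ x : Xs N, Phi M a (y + pt N x) ≤
      ∫ y in Set.Icc (0 : ℝ) 1 ×ˢ Set.Icc (0 : ℝ) 1, K * Fintype.card (Xs N) := by
    refine integral_mono (integrable_finsetSum _ fun x _ => hi x) ?_ fun y => sum_pt N M hN hM a y
    exact (continuous_const.continuousOn.integrableOn_compact hK)
  rw [e1, setIntegral_const] at e2
  have hv : (volume.real (Set.Icc (0 : ℝ) 1 ×ˢ Set.Icc (0 : ℝ) 1)) = 1 := by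
    rw [Measure.volume_eq_prod, measureReal_prod_prod]; simp
  rw [hv, one_smul, mul_comm] at e2
  exact le_of_mul_le_mul_right e2 hcard

end DRP

/-- **Discrete restriction for the parabola.**
For every `ε > 0` there is `C_ε > 0` so that for every `M ≥ 2` and all complex `a_1, …, a_M`,
`‖∑_{n=1}^M a_n e(n x₁ + n² x₂)‖_{L⁶([0,1]²)} ≤ C_ε (log M)^{2+ε} (∑ |a_n|²)^{1/2}`. -/
theorem discrete_restriction_parabola :
    ∀ ε : ℝ, 0 < ε → ∃ C : ℝ, 0 < C ∧ ∀ M : ℕ, 2 ≤ M → ∀ a : ℕ → ℂ,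
      (∫ x : ℝ × ℝ in Set.Icc (0 : ℝ) 1 ×ˢ Set.Icc (0 : ℝ) 1,
          ‖∑ n ∈ Finset.Icc 1 M,
              a n * Complex.exp (2 * Real.pi * Complex.I *
                ((n : ℂ) * (x.1 : ℂ) + (n : ℂ) ^ 2 * (x.2 : ℂ)))‖ ^ 6) ^ ((1 : ℝ) / 6)
        ≤ C * (Real.log M) ^ ((2 : ℝ) + ε) *
            (∑ n ∈ Finset.Icc 1 M, ‖a n‖ ^ 2) ^ ((1 : ℝ) / 2) := by
  intro ε hε
  have hl2 : 0 < Real.log 2 := Real.log_pos (by norm_num)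
  have hC0 := DRP.C0_pos
  refine ⟨DRP.C0 ^ ((1 : ℝ) / 6) * (3 / Real.log 2) ^ 2 * (Real.log 2) ^ (-ε), by positivity, ?_⟩
  intro M hM a
  set N := Nat.log 3 M + 1 with hN
  have hMN : M < 3 ^ N := Nat.lt_pow_succ_log_self (by norm_num) M
  have hmain := DRP.int_main N M (by omega) hMN a
  have hlM : Real.log 2 ≤ Real.log M := Real.log_le_log (by norm_num) (by exact_mod_cast hM)
  have hlM0 : 0 < Real.log M := by linarith
  have hNl : (N : ℝ) ≤ 3 / Real.log 2 * Real.log M := by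
    have h1 : (3 : ℝ) ^ (Nat.log 3 M) ≤ M := by
      exact_mod_cast Nat.pow_log_le_self 3 (by omega)
    have h2 := Real.log_le_log (by positivity) h1
    rw [Real.log_pow] at h2
    have h3 : Real.log 2 ≤ Real.log 3 := Real.log_le_log (by norm_num) (by norm_num)
    have h4 : (Nat.log 3 M : ℝ) * Real.log 2 ≤ Real.log M :=
      le_trans (by gcongr) h2
    rw [div_mul_eq_mul_div, le_div_iff₀ hl2, hN]
    push_cast
    nlinarith
  set R := ∑ n ∈ Finset.Icc 1 M, ‖a n‖ ^ 2 with hR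
  have hR0 : 0 ≤ R := Finset.sum_nonneg fun _ _ => by positivity
  have hI0 : 0 ≤ ∫ y in Set.Icc (0 : ℝ) 1 ×ˢ Set.Icc (0 : ℝ) 1, DRP.Phi M a y :=
    integral_nonneg fun y => by unfold DRP.Phi; positivity
  calc _ = (∫ y in Set.Icc (0 : ℝ) 1 ×ˢ Set.Icc (0 : ℝ) 1, DRP.Phi M a y) ^ ((1 : ℝ) / 6) := rfl
    _ ≤ (DRP.C0 * N ^ 12 * R ^ 3) ^ ((1 : ℝ) / 6) := Real.rpow_le_rpow hI0 hmain (by norm_num)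
    _ = DRP.C0 ^ ((1 : ℝ) / 6) * (N : ℝ) ^ 2 * R ^ ((1 : ℝ) / 2) := by
        rw [Real.mul_rpow (by positivity) (by positivity), Real.mul_rpow (by positivity) (by positivity),
          ← Real.rpow_natCast (N : ℝ) 12, ← Real.rpow_natCast R 3, ← Real.rpow_mul (by positivity),
          ← Real.rpow_mul (by positivity), ← Real.rpow_natCast (N : ℝ) 2]
        norm_num
    _ ≤ DRP.C0 ^ ((1 : ℝ) / 6) * (3 / Real.log 2 * Real.log M) ^ 2 * R ^ ((1 : ℝ) / 2) := by
        gcongr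
    _ = DRP.C0 ^ ((1 : ℝ) / 6) * (3 / Real.log 2) ^ 2 * (Real.log M) ^ 2 * R ^ ((1 : ℝ) / 2) := by ring
    _ ≤ DRP.C0 ^ ((1 : ℝ) / 6) * (3 / Real.log 2) ^ 2 *
        ((Real.log 2) ^ (-ε) * (Real.log M) ^ ((2 : ℝ) + ε)) * R ^ ((1 : ℝ) / 2) := by
        have : (Real.log M) ^ 2 ≤ (Real.log 2) ^ (-ε) * (Real.log M) ^ ((2 : ℝ) + ε) := by
          rw [Real.rpow_add hlM0, Real.rpow_two, Real.rpow_neg hl2.le]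
          have h5 := Real.rpow_le_rpow hl2.le hlM hε.le
          have h6 : 0 < (Real.log 2) ^ ε := by positivity
          rw [inv_mul_eq_div, le_div_iff₀ h6]
          gcongr
        gcongr
    _ = _ := by ring
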